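/- arXiv:1411.0758 — 10 statements merged into one kernel-verified Lean document; each statement's English description precedes it below -/
import Mathlib

section
/- For every integer m, the identity S_{m−1}·(ω + (ω² − 4)·S_{m−1}·S_m) + S_m = S_{3m} holds in the polynomial ring ℤ[ω]. -/
open Polynomial

/-- Extending the sequence backwards from `S 0 = 1`, `S 1 = x` gives `S (-1) = 0`. -/
lemma neg_one_of_rec {R : Type*} [CommRing R] {x : R} {S : ℤ → R}
    (hS0 : S 0 = 1) (hS1 : S 1 = x) (hSrec : ∀ j : ℤ, S (j + 1) = x * S j - S (j - 1)) :
    S (-1) = 0 := by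
  have h := hSrec 0
  simp only [zero_add, zero_sub, hS0, hS1] at h
  linear_combination h

/-- Consecutive terms of the sequence satisfy a quadratic relation. -/
lemma sq_add_sq_sub_of_rec {R : Type*} [CommRing R] {x : R} {S : ℤ → R}
    (hS0 : S 0 = 1) (hS1 : S 1 = x) (hSrec : ∀ j : ℤ, S (j + 1) = x * S j - S (j - 1)) (m : ℤ) :
    S (m - 1) ^ 2 + S m ^ 2 - x * S (m - 1) * S m = 1 := by
  induction m using Int.induction_on with
  | zero =>
    simp [hS0, neg_one_of_rec hS0 hS1 hSrec]
  | succ k ih =>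
    rw [add_sub_cancel_right, hSrec]
    linear_combination ih
  | pred k ih =>
    have h := hSrec (-k - 1)
    rw [sub_add_cancel] at h
    rw [h] at ih
    linear_combination ih

/-- The addition formula for the sequence. -/
lemma add_of_rec {R : Type*} [CommRing R] {x : R} {S : ℤ → R}
    (hS0 : S 0 = 1) (hS1 : S 1 = x) (hSrec : ∀ j : ℤ, S (j + 1) = x * S j - S (j - 1))
    (m n : ℤ) : S (m + n) = S m * S n - S (m - 1) * S (n - 1) := by
  induction n using Int.induction_on generalizing m with
  | zero => simp [hS0, neg_one_of_rec hS0 hS1 hSrec]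
  | succ k ih =>
    have h := ih (m + 1)
    rw [add_sub_cancel_right, hSrec m] at h
    rw [show m + (k + 1 : ℤ) = m + 1 + k by ring, h, add_sub_cancel_right, hSrec k]
    ring
  | pred k ih =>
    have h := ih (m - 1)
    have hm := hSrec (m - 1)
    have hk := hSrec (-k - 1)
    rw [sub_add_cancel] at hm hk
    rw [show m + (-k - 1 : ℤ) = m - 1 + -k by ring, h, hm, hk]
    ring

/-- For every integer `m`, the identity
`S_{m−1}·(ω + (ω² − 4)·S_{m−1}·S_m) + S_m = S_{3m}` holds in `ℤ[ω]`, where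
`S : ℤ → ℤ[ω]` satisfies `S 0 = 1`, `S 1 = ω` and `S (j+1) = ω·S j − S (j−1)` for all `j`. -/
theorem statement5 (S : ℤ → Polynomial ℤ)
    (hS0 : S 0 = 1) (hS1 : S 1 = X)
    (hSrec : ∀ j : ℤ, S (j + 1) = X * S j - S (j - 1)) :
    ∀ m : ℤ, S (m - 1) * (X + (X ^ 2 - 4) * S (m - 1) * S m) + S m = S (3 * m) := by
  intro m
  have hinv := sq_add_sq_sub_of_rec hS0 hS1 hSrec m
  have hprev := hSrec (m - 1)
  have h₂ := add_of_rec hS0 hS1 hSrec m m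
  have h₁ := add_of_rec hS0 hS1 hSrec (m - 1) m
  have h₃ := add_of_rec hS0 hS1 hSrec (m + m) m
  rw [show m - 1 + 1 = m by ring] at hprev
  rw [show m - 1 + m = m + m - 1 by ring] at h₁
  rw [show 3 * m = m + m + m by ring, h₃, h₂, h₁]
  linear_combination (-(X * S (m - 1) + S m)) * hinv - S (m - 1) ^ 2 * hprev
end

section
/- Let A, B ∈ SL₂(ℂ) and let m be an integer. Set x = tr(A), y = tr(B), z = tr(A·B⁻¹). Then tr((A·B⁻¹)^m · A·B · (A⁻¹·B)^m) = (x·S_m(z) − y·S_{m−1}(z))·(y·S_m(z) − x·S_{m−1}(z)) − z·(S_m(z)² + S_{m−1}(z)²) + 4·S_m(z)·S_{m−1}(z). -/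
open Polynomial

/-- If `S : ℤ → R` satisfies the Chebyshev recurrence at the trace of `M ∈ SL₂(R)`, then
`M ^ m = S m • 1 - S (m - 1) • M⁻¹` for all integers `m`. -/
theorem Matrix.SpecialLinearGroup.coe_zpow_eq_chebyshev {R : Type*} [CommRing R]
    (M : Matrix.SpecialLinearGroup (Fin 2) R) (S : ℤ → R) (hS0 : S 0 = 1)
    (hS1 : S 1 = Matrix.trace (M : Matrix (Fin 2) (Fin 2) R))
    (hSrec : ∀ j : ℤ,
      S (j + 1) = Matrix.trace (M : Matrix (Fin 2) (Fin 2) R) * S j - S (j - 1))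
    (m : ℤ) :
    ((M ^ m : Matrix.SpecialLinearGroup (Fin 2) R) : Matrix (Fin 2) (Fin 2) R) =
      S m • 1 - S (m - 1) •
        ((M⁻¹ : Matrix.SpecialLinearGroup (Fin 2) R) : Matrix (Fin 2) (Fin 2) R) := by
  have hdet := M.det_coe
  rw [Matrix.det_fin_two] at hdet
  induction m using Int.induction_on with
  | zero =>
    have h := hSrec 0
    rw [zero_add, hS1, hS0] at h
    have h' : S (0 - 1) = 0 := by linear_combination h
    rw [hS0, h', zero_smul, sub_zero, one_smul]
    rfl
  | succ n ih =>
    rw [_root_.zpow_add_one, Matrix.SpecialLinearGroup.coe_mul, ih, hSrec, add_sub_cancel_right]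
    ext i j
    fin_cases i <;> fin_cases j <;>
      simp [Matrix.mul_apply, Fin.sum_univ_two, Matrix.SpecialLinearGroup.coe_inv,
        Matrix.adjugate_fin_two, Matrix.trace_fin_two]
    · linear_combination (-S (n - 1)) * hdet
    · ring
    · ring
    · linear_combination (-S (n - 1)) * hdet
  | pred n ih =>
    have h := hSrec (-n - 1)
    rw [sub_add_cancel] at h
    have h' : S (-n - 1 - 1) =
        Matrix.trace (M : Matrix (Fin 2) (Fin 2) R) * S (-n - 1) - S (-n) := by
      linear_combination h
    rw [_root_.zpow_sub_one, Matrix.SpecialLinearGroup.coe_mul, ih, h']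
    ext i j
    fin_cases i <;> fin_cases j <;>
      simp [Matrix.mul_apply, Fin.sum_univ_two, Matrix.SpecialLinearGroup.coe_inv,
        Matrix.adjugate_fin_two, Matrix.trace_fin_two]
    · linear_combination S (-n - 1) * hdet
    · ring
    · ring
    · linear_combination S (-n - 1) * hdet

/-- Let `A, B ∈ SL₂(ℂ)` and let `m` be an integer.  Set `x = tr A`,
`y = tr B`, `z = tr (A·B⁻¹)`.  Then
`tr ((A·B⁻¹)^m · A·B · (A⁻¹·B)^m)
  = (x·S_m(z) − y·S_{m−1}(z))·(y·S_m(z) − x·S_{m−1}(z)) − z·(S_m(z)² + S_{m−1}(z)²)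
    + 4·S_m(z)·S_{m−1}(z)`,
where `S : ℤ → ℤ[ω]` satisfies `S 0 = 1`, `S 1 = ω` and `S (j+1) = ω·S j − S (j−1)`
for all `j`. -/
theorem statement6 (S : ℤ → Polynomial ℤ)
    (hS0 : S 0 = 1) (hS1 : S 1 = X)
    (hSrec : ∀ j : ℤ, S (j + 1) = X * S j - S (j - 1))
    (A B : Matrix.SpecialLinearGroup (Fin 2) ℂ) (m : ℤ)
    (x y z : ℂ)
    (hx : x = Matrix.trace (A : Matrix (Fin 2) (Fin 2) ℂ))
    (hy : y = Matrix.trace (B : Matrix (Fin 2) (Fin 2) ℂ))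
    (hz : z = Matrix.trace ((A * B⁻¹ : Matrix.SpecialLinearGroup (Fin 2) ℂ) :
      Matrix (Fin 2) (Fin 2) ℂ)) :
    Matrix.trace (((A * B⁻¹) ^ m * A * B * (A⁻¹ * B) ^ m :
        Matrix.SpecialLinearGroup (Fin 2) ℂ) : Matrix (Fin 2) (Fin 2) ℂ) =
      (x * Polynomial.aeval z (S m) - y * Polynomial.aeval z (S (m - 1))) *
          (y * Polynomial.aeval z (S m) - x * Polynomial.aeval z (S (m - 1))) -
        z * ((Polynomial.aeval z (S m)) ^ 2 + (Polynomial.aeval z (S (m - 1))) ^ 2) +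
        4 * Polynomial.aeval z (S m) * Polynomial.aeval z (S (m - 1)) := by
  have hzD : z = Matrix.trace ((A⁻¹ * B : Matrix.SpecialLinearGroup (Fin 2) ℂ) :
      Matrix (Fin 2) (Fin 2) ℂ) := by
    rw [hz]
    simp only [Matrix.SpecialLinearGroup.coe_mul, Matrix.SpecialLinearGroup.coe_inv,
      Matrix.adjugate_fin_two, Matrix.trace_fin_two, Matrix.mul_apply, Fin.sum_univ_two,
      Matrix.of_apply, Matrix.cons_val', Matrix.cons_val_zero, Matrix.cons_val_one,
      Matrix.cons_val_fin_one]
    ring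
  have hC := (A * B⁻¹).coe_zpow_eq_chebyshev (fun j => aeval z (S j)) (by simp [hS0])
    (by rw [← hz, hS1, aeval_X])
    (fun j => by rw [← hz, hSrec, map_sub, map_mul, aeval_X]) m
  have hD := (A⁻¹ * B).coe_zpow_eq_chebyshev (fun j => aeval z (S j)) (by simp [hS0])
    (by rw [← hzD, hS1, aeval_X])
    (fun j => by rw [← hzD, hSrec, map_sub, map_mul, aeval_X]) m
  generalize aeval z (S m) = s at *
  generalize aeval z (S (m - 1)) = t at *
  have expand : Matrix.trace (((A * B⁻¹) ^ m * A * B * (A⁻¹ * B) ^ m :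
        Matrix.SpecialLinearGroup (Fin 2) ℂ) : Matrix (Fin 2) (Fin 2) ℂ) =
      s ^ 2 * Matrix.trace ((A * B : Matrix.SpecialLinearGroup (Fin 2) ℂ) :
          Matrix (Fin 2) (Fin 2) ℂ)
        - s * t * Matrix.trace (((A * B⁻¹)⁻¹ * (A * B) :
          Matrix.SpecialLinearGroup (Fin 2) ℂ) : Matrix (Fin 2) (Fin 2) ℂ)
        - s * t * Matrix.trace ((A * B * (A⁻¹ * B)⁻¹ :
          Matrix.SpecialLinearGroup (Fin 2) ℂ) : Matrix (Fin 2) (Fin 2) ℂ)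
        + t ^ 2 * Matrix.trace (((A * B⁻¹)⁻¹ * (A * B) * (A⁻¹ * B)⁻¹ :
          Matrix.SpecialLinearGroup (Fin 2) ℂ) : Matrix (Fin 2) (Fin 2) ℂ) := by
    have hprod : (((A * B⁻¹) ^ m * A * B * (A⁻¹ * B) ^ m :
        Matrix.SpecialLinearGroup (Fin 2) ℂ) : Matrix (Fin 2) (Fin 2) ℂ) =
        ((A * B⁻¹) ^ m).1 * (A * B).1 * ((A⁻¹ * B) ^ m).1 :=
      congrArg (fun M => M.1 * ((A⁻¹ * B) ^ m).1) (mul_assoc ((A * B⁻¹) ^ m) A B)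
    rw [hprod, hC, hD, Matrix.SpecialLinearGroup.coe_mul _ (A⁻¹ * B)⁻¹,
      Matrix.SpecialLinearGroup.coe_mul _ (A⁻¹ * B)⁻¹,
      Matrix.SpecialLinearGroup.coe_mul (A * B⁻¹)⁻¹]
    simp only [sub_mul, mul_sub, smul_mul_assoc, mul_smul_comm, one_mul, mul_one,
      Matrix.trace_sub, Matrix.trace_smul, smul_eq_mul]
    ring
  have hB : (A * B⁻¹)⁻¹ * (A * B) = B * B := by group
  have hA : A * B * (A⁻¹ * B)⁻¹ = A * A := by group
  have hBA : B * B * (A⁻¹ * B)⁻¹ = B * A := by group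
  have hdA := A.det_coe
  have hdB := B.det_coe
  rw [Matrix.det_fin_two] at hdA hdB
  rw [expand, hB, hA, hBA, hx, hy, hz]
  simp only [Matrix.SpecialLinearGroup.coe_mul, Matrix.SpecialLinearGroup.coe_inv,
    Matrix.adjugate_fin_two, Matrix.trace_fin_two, Matrix.mul_apply, Fin.sum_univ_two,
    Matrix.of_apply, Matrix.cons_val', Matrix.cons_val_zero, Matrix.cons_val_one,
    Matrix.cons_val_fin_one]
  linear_combination (2 * s * t) * hdA + (2 * s * t) * hdB
end

section
/- Let A, B ∈ SL₂(ℂ) and let m, n be integers. Set x = tr(A), y = tr(B), z = tr(A·B⁻¹), W = (A·B⁻¹)^m · A·B · (A⁻¹·B)^m, t = tr(W), and R = W^n · (A·B⁻¹)^m. Then tr(R·A·B) − tr(B·A·R) = (x·y·z + 4 − x² − y² − z²)·(S_n(t)·S_{m−1}(z) − S_{n−1}(t)·S_m(z)). -/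
open Polynomial

open Matrix

local notation:max "↑ₘ[" K "]" g:max => ((g : Matrix.SpecialLinearGroup (Fin 2) K) : Matrix (Fin 2) (Fin 2) K)

namespace Matrix.SpecialLinearGroup

variable {K : Type*} [CommRing K]

/-- The Cayley-Hamilton relation in `SL₂`. -/
theorem coe_add_coe_inv (g : Matrix.SpecialLinearGroup (Fin 2) K) :
    ↑ₘ[K]g + ↑ₘ[K](g⁻¹) = trace ↑ₘ[K]g • 1 := by
  ext i j
  fin_cases i <;> fin_cases j <;>
    simp [coe_inv, adjugate_fin_two, trace_fin_two, add_comm]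

theorem trace_coe_inv (g : Matrix.SpecialLinearGroup (Fin 2) K) :
    trace ↑ₘ[K](g⁻¹) = trace ↑ₘ[K]g := by
  simp [coe_inv, adjugate_fin_two, trace_fin_two, add_comm]

/-- Integer powers in `SL₂` are given by any sequence satisfying the Chebyshev recurrence. -/
theorem coe_zpow_eq (g : Matrix.SpecialLinearGroup (Fin 2) K) (s : ℤ → K)
    (h0 : s 0 = 1) (h1 : s (-1) = 0)
    (hrec : ∀ j, s (j + 1) = trace ↑ₘ[K]g * s j - s (j - 1)) (k : ℤ) :
    ↑ₘ[K](g ^ k) = s k • 1 - s (k - 1) • ↑ₘ[K](g⁻¹) := by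
  have hg := coe_add_coe_inv g
  have hmul : ↑ₘ[K]g * ↑ₘ[K](g⁻¹) = 1 := by
    rw [← coe_mul, mul_inv_cancel, coe_one]
  induction k using Int.induction_on with
  | zero => simp [h0, h1]
  | succ k ih =>
    have hg' := eq_sub_of_add_eq hg
    rw [add_comm, _root_.zpow_add, _root_.zpow_one, coe_mul, ih, mul_sub,
      mul_smul_comm, mul_smul_comm, hmul, mul_one, hg', add_comm 1, hrec, add_sub_cancel_right]
    module
  | pred k ih =>
    have hg' : ↑ₘ[K]g = _ := eq_sub_of_add_eq hg
    have hsq : ↑ₘ[K](g⁻¹) * ↑ₘ[K](g⁻¹) = trace ↑ₘ[K]g • ↑ₘ[K](g⁻¹) - 1 := by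
      rw [← hmul, hg', sub_mul, smul_mul_assoc, one_mul, ← hg', sub_sub_cancel]
    have hs := hrec (-k - 1)
    rw [sub_add_cancel] at hs
    rw [_root_.zpow_sub_one, coe_mul, ih, sub_mul, smul_mul_assoc, smul_mul_assoc, hsq,
      one_mul, hs]
    module

theorem trace_inv_pow_mul_commutator (A B : Matrix.SpecialLinearGroup (Fin 2) K)
    (p q : K) :
    trace ((p • 1 - q • ↑ₘ[K]((A * B⁻¹)⁻¹)) * (↑ₘ[K]A * ↑ₘ[K]B - ↑ₘ[K]B * ↑ₘ[K]A)) =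
      (trace ↑ₘ[K]A * trace ↑ₘ[K]B * trace ↑ₘ[K](A * B⁻¹) + 4 - trace ↑ₘ[K]A ^ 2 - trace ↑ₘ[K]B ^ 2
        - trace ↑ₘ[K](A * B⁻¹) ^ 2) * q := by
  have hA := A.det_coe
  have hB := B.det_coe
  rw [det_fin_two] at hA hB
  simp only [_root_.mul_inv_rev, inv_inv, coe_mul, coe_inv, adjugate_fin_two, trace_fin_two,
    mul_apply, Fin.sum_univ_two, sub_apply, smul_apply, one_apply, of_apply, cons_val',
    cons_val_zero, cons_val_one, cons_val_fin_one, smul_eq_mul]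
  simp
  set a := ↑ₘ[K]A 0 0
  set b := ↑ₘ[K]A 0 1
  set c := ↑ₘ[K]A 1 0
  set d := ↑ₘ[K]A 1 1
  set e := ↑ₘ[K]B 0 0
  set f := ↑ₘ[K]B 0 1
  set g := ↑ₘ[K]B 1 0
  set h := ↑ₘ[K]B 1 1
  linear_combination q * (4 * (e * h - f * g) * hA + 4 * hB - (a + d) ^ 2 * hB - (e + h) ^ 2 * hA)

theorem trace_inv_pow_mul_inv_mul_commutator (A B : Matrix.SpecialLinearGroup (Fin 2) K)
    (p q : K) :
    trace ((p • 1 - q • ↑ₘ[K](A⁻¹ * B)) * ↑ₘ[K](B⁻¹ * A⁻¹) * (↑ₘ[K]A * ↑ₘ[K]B - ↑ₘ[K]B * ↑ₘ[K]A)) =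
      (trace ↑ₘ[K]A * trace ↑ₘ[K]B * trace ↑ₘ[K](A * B⁻¹) + 4 - trace ↑ₘ[K]A ^ 2 - trace ↑ₘ[K]B ^ 2
        - trace ↑ₘ[K](A * B⁻¹) ^ 2) * p := by
  have hA := A.det_coe
  have hB := B.det_coe
  rw [det_fin_two] at hA hB
  simp only [coe_mul, coe_inv, adjugate_fin_two, trace_fin_two,
    mul_apply, Fin.sum_univ_two, sub_apply, smul_apply, one_apply, of_apply, cons_val',
    cons_val_zero, cons_val_one, cons_val_fin_one, smul_eq_mul]
  simp
  set a := ↑ₘ[K]A 0 0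
  set b := ↑ₘ[K]A 0 1
  set c := ↑ₘ[K]A 1 0
  set d := ↑ₘ[K]A 1 1
  set e := ↑ₘ[K]B 0 0
  set f := ↑ₘ[K]B 0 1
  set g := ↑ₘ[K]B 1 0
  set h := ↑ₘ[K]B 1 1
  linear_combination p * (4 * (e * h - f * g) * hA + 4 * hB - (a + d) ^ 2 * hB - (e + h) ^ 2 * hA)

end Matrix.SpecialLinearGroup

/-- Let `A, B ∈ SL₂(ℂ)` and `m, n` integers.  Set `x = tr A`, `y = tr B`,
`z = tr (A·B⁻¹)`, `W = (A·B⁻¹)^m · A·B · (A⁻¹·B)^m`, `t = tr W`, `R = W^n · (A·B⁻¹)^m`.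
Then `tr (R·A·B) − tr (B·A·R)
  = (x·y·z + 4 − x² − y² − z²)·(S_n(t)·S_{m−1}(z) − S_{n−1}(t)·S_m(z))`,
where `S : ℤ → ℤ[ω]` satisfies `S 0 = 1`, `S 1 = ω` and `S (j+1) = ω·S j − S (j−1)`
for all `j`. -/
theorem statement7 (S : ℤ → Polynomial ℤ)
    (hS0 : S 0 = 1) (hS1 : S 1 = X)
    (hSrec : ∀ j : ℤ, S (j + 1) = X * S j - S (j - 1))
    (A B : Matrix.SpecialLinearGroup (Fin 2) ℂ) (m n : ℤ)
    (x y z t : ℂ) (W R : Matrix.SpecialLinearGroup (Fin 2) ℂ)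
    (hx : x = Matrix.trace (A : Matrix (Fin 2) (Fin 2) ℂ))
    (hy : y = Matrix.trace (B : Matrix (Fin 2) (Fin 2) ℂ))
    (hz : z = Matrix.trace ((A * B⁻¹ : Matrix.SpecialLinearGroup (Fin 2) ℂ) :
      Matrix (Fin 2) (Fin 2) ℂ))
    (hW : W = (A * B⁻¹) ^ m * A * B * (A⁻¹ * B) ^ m)
    (ht : t = Matrix.trace ((W : Matrix.SpecialLinearGroup (Fin 2) ℂ) :
      Matrix (Fin 2) (Fin 2) ℂ))
    (hR : R = W ^ n * (A * B⁻¹) ^ m) :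
    Matrix.trace ((R * A * B : Matrix.SpecialLinearGroup (Fin 2) ℂ) :
        Matrix (Fin 2) (Fin 2) ℂ) -
      Matrix.trace ((B * A * R : Matrix.SpecialLinearGroup (Fin 2) ℂ) :
        Matrix (Fin 2) (Fin 2) ℂ) =
      (x * y * z + 4 - x ^ 2 - y ^ 2 - z ^ 2) *
        (Polynomial.aeval t (S n) * Polynomial.aeval z (S (m - 1)) -
          Polynomial.aeval t (S (n - 1)) * Polynomial.aeval z (S m)) := by
  have hSm1 : S (-1) = 0 := by
    have h := hSrec 0
    rw [zero_add, zero_sub, hS0, hS1, mul_one] at h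
    linear_combination h
  have hpow (g : Matrix.SpecialLinearGroup (Fin 2) ℂ) (k : ℤ) :
      ↑ₘ[ℂ](g ^ k) = aeval (trace ↑ₘ[ℂ]g) (S k) • 1 - aeval (trace ↑ₘ[ℂ]g) (S (k - 1)) • ↑ₘ[ℂ](g⁻¹) :=
    Matrix.SpecialLinearGroup.coe_zpow_eq g (fun j => aeval (trace ↑ₘ[ℂ]g) (S j)) (by simp [hS0]) (by simp [hSm1])
      (fun j => by simp [hSrec j]) k
  have hz' : trace ↑ₘ[ℂ](A⁻¹ * B) = z := by
    rw [hz, ← Matrix.SpecialLinearGroup.trace_coe_inv, _root_.mul_inv_rev, inv_inv, Matrix.SpecialLinearGroup.coe_mul,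
      trace_mul_comm, ← Matrix.SpecialLinearGroup.coe_mul]
  have hQ : ↑ₘ[ℂ]((A⁻¹ * B) ^ (-m)) =
      aeval z (S m) • 1 - aeval z (S (m - 1)) • ↑ₘ[ℂ](A⁻¹ * B) := by
    rw [← _root_.inv_zpow', hpow, Matrix.SpecialLinearGroup.trace_coe_inv, hz', inv_inv]
  have hWP : W⁻¹ * (A * B⁻¹) ^ m = (A⁻¹ * B) ^ (-m) * (B⁻¹ * A⁻¹) := by
    rw [hW]
    group
  have hR' : ↑ₘ[ℂ]R = aeval t (S n) • ↑ₘ[ℂ]((A * B⁻¹) ^ m) -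
      aeval t (S (n - 1)) • (↑ₘ[ℂ]((A⁻¹ * B) ^ (-m)) * ↑ₘ[ℂ](B⁻¹ * A⁻¹)) := by
    rw [hR, Matrix.SpecialLinearGroup.coe_mul, hpow W, ← ht, sub_mul, smul_mul_assoc, smul_mul_assoc,
      one_mul, ← Matrix.SpecialLinearGroup.coe_mul, hWP, Matrix.SpecialLinearGroup.coe_mul]
  have hcomm : trace ↑ₘ[ℂ](R * A * B) - trace ↑ₘ[ℂ](B * A * R) =
      trace (↑ₘ[ℂ]R * (↑ₘ[ℂ]A * ↑ₘ[ℂ]B - ↑ₘ[ℂ]B * ↑ₘ[ℂ]A)) := by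
    simp only [Matrix.SpecialLinearGroup.coe_mul]
    rw [trace_mul_comm (↑ₘ[ℂ]B * ↑ₘ[ℂ]A), mul_sub, trace_sub, mul_assoc]
  have h₁ := Matrix.SpecialLinearGroup.trace_inv_pow_mul_commutator A B
    (aeval z (S m)) (aeval z (S (m - 1)))
  have h₂ := Matrix.SpecialLinearGroup.trace_inv_pow_mul_inv_mul_commutator A B
    (aeval z (S m)) (aeval z (S (m - 1)))
  rw [← hQ, ← hx, ← hy, ← hz] at h₂
  have hP := hpow (A * B⁻¹) m
  rw [← hz] at hP
  rw [← hP, ← hx, ← hy, ← hz] at h₁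
  rw [hcomm, hR', sub_mul, smul_mul_assoc, smul_mul_assoc, trace_sub, trace_smul, trace_smul,
    h₁, h₂, smul_eq_mul, smul_eq_mul]
  ring
end

section
/- For every integer j, the identity (ω² − 4)·Δ_j = S_{2j} − (2j+1) holds in the polynomial ring ℤ[ω]. -/
open Polynomial

section Recurrence

variable {R : Type*} [CommRing R] {x : R} {S : ℤ → R}

theorem neg_one_eq_zero_of_recurrence (hS0 : S 0 = 1) (hS1 : S 1 = x)
    (hSrec : ∀ j : ℤ, S (j + 1) = x * S j - S (j - 1)) : S (-1) = 0 := by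
  have h := hSrec 0
  rw [zero_add, zero_sub, hS0, hS1] at h
  linear_combination h

/-- The quadratic invariant of a two-sided sequence with `S (j + 1) = x * S j - S (j - 1)`. -/
theorem sq_add_sq_sub_of_recurrence (hS0 : S 0 = 1) (hS1 : S 1 = x)
    (hSrec : ∀ j : ℤ, S (j + 1) = x * S j - S (j - 1)) (j : ℤ) :
    S j ^ 2 + S (j - 1) ^ 2 - x * S j * S (j - 1) = 1 := by
  have hstep : ∀ i : ℤ, S (i + 1) ^ 2 + S i ^ 2 - x * S (i + 1) * S i =
      S i ^ 2 + S (i - 1) ^ 2 - x * S i * S (i - 1) := fun i => by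
    rw [hSrec i]; ring
  have hneg := neg_one_eq_zero_of_recurrence hS0 hS1 hSrec
  induction j using Int.induction_on with
  | zero => simp [hS0, hneg]
  | succ n ih => rw [add_sub_cancel_right, hstep, ih]
  | pred n ih =>
    have h := hstep (-(n : ℤ) - 1)
    rw [sub_add_cancel] at h
    rw [← h, ih]

/-- Doubling formulas for a two-sided sequence with `S (j + 1) = x * S j - S (j - 1)`. -/
theorem double_of_recurrence (hS0 : S 0 = 1) (hS1 : S 1 = x)
    (hSrec : ∀ j : ℤ, S (j + 1) = x * S j - S (j - 1)) (j : ℤ) :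
    S (2 * j) = S j ^ 2 - S (j - 1) ^ 2 ∧
      S (2 * j - 1) = 2 * S j * S (j - 1) - x * S (j - 1) ^ 2 := by
  have hneg := neg_one_eq_zero_of_recurrence hS0 hS1 hSrec
  induction j using Int.induction_on with
  | zero => simp [hS0, hneg]
  | succ n ih =>
    obtain ⟨h₁, h₂⟩ := ih
    have e₁ := hSrec (2 * (n : ℤ))
    have e₂ := hSrec (2 * (n : ℤ) + 1)
    have e₃ := hSrec n
    rw [show 2 * (n : ℤ) + 1 + 1 = 2 * (n + 1) by ring, add_sub_cancel_right] at e₂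
    rw [show 2 * ((n : ℤ) + 1) - 1 = 2 * n + 1 by ring, add_sub_cancel_right, e₂, e₁, e₃, h₁, h₂]
    constructor <;> ring
  | pred n ih =>
    obtain ⟨h₁, h₂⟩ := ih
    have e₁ := hSrec (2 * -(n : ℤ) - 1)
    have e₂ := hSrec (2 * (-(n : ℤ) - 1))
    have e₃ := hSrec (-(n : ℤ) - 1)
    rw [sub_add_cancel, show 2 * -(n : ℤ) - 1 - 1 = 2 * (-n - 1) by ring] at e₁
    rw [show 2 * (-(n : ℤ) - 1) + 1 = 2 * -n - 1 by ring] at e₂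
    rw [sub_add_cancel] at e₃
    rw [h₁, h₂, e₃] at e₁
    rw [h₂, e₃] at e₂
    constructor
    · linear_combination e₁
    · linear_combination e₂ + x * e₁

end Recurrence

/-- For every integer `j`, the identity
`(ω² − 4)·Δ_j = S_{2j} − (2j+1)` holds in `ℤ[ω]`, where
`Δ_j = S_j′·S_{j−1} − S_j·S_{j−1}′` (formal derivatives) and `S : ℤ → ℤ[ω]`
satisfies `S 0 = 1`, `S 1 = ω` and `S (j+1) = ω·S j − S (j−1)` for all `j`. -/
theorem statement8 (S : ℤ → Polynomial ℤ)
    (hS0 : S 0 = 1) (hS1 : S 1 = X)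
    (hSrec : ∀ j : ℤ, S (j + 1) = X * S j - S (j - 1)) :
    ∀ j : ℤ,
      (X ^ 2 - 4) * (derivative (S j) * S (j - 1) - S j * derivative (S (j - 1))) =
        S (2 * j) - Polynomial.C (2 * j + 1) := by
  have hstep : ∀ i : ℤ,
      (X ^ 2 - 4) * (derivative (S (i + 1)) * S i - S (i + 1) * derivative (S i)) -
          (S (2 * (i + 1)) - Polynomial.C (2 * (i + 1) + 1)) =
        (X ^ 2 - 4) * (derivative (S i) * S (i - 1) - S i * derivative (S (i - 1))) -
          (S (2 * i) - Polynomial.C (2 * i + 1)) := fun i => by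
    have hq := sq_add_sq_sub_of_recurrence hS0 hS1 hSrec i
    rw [(double_of_recurrence hS0 hS1 hSrec (i + 1)).1,
      (double_of_recurrence hS0 hS1 hSrec i).1, add_sub_cancel_right, hSrec i]
    simp only [derivative_sub, derivative_mul, derivative_X, map_add, map_mul, map_one,
      map_ofNat]
    linear_combination -2 * hq
  intro j
  rw [← sub_eq_zero]
  induction j using Int.induction_on with
  | zero =>
    simp [hS0, neg_one_eq_zero_of_recurrence hS0 hS1 hSrec]
  | succ n ih => rw [add_sub_cancel_right, hstep, ih]
  | pred n ih =>
    have h := hstep (-(n : ℤ) - 1)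
    rw [sub_add_cancel] at h
    rw [← h, ih]
end

section
/- For every integer j, the identity (ω² − 4)²·H_j = (2j−2)·ω·S_{2j} − (4j+2)·S_{2j−1} + (4j+2)·ω holds in the polynomial ring ℤ[ω]. -/
open Polynomial

/-- A sequence of second-kind Chebyshev type satisfies a quadratic invariant, index-doubling
formulas, and first-order differential relations between consecutive terms. -/
theorem recurrence_invariants (S : ℤ → Polynomial ℤ)
    (hS0 : S 0 = 1) (hS1 : S 1 = X)
    (hSrec : ∀ j : ℤ, S (j + 1) = X * S j - S (j - 1)) (j : ℤ) :
    S j ^ 2 + S (j - 1) ^ 2 - X * S j * S (j - 1) = 1 ∧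
    S (2 * j) = S j ^ 2 - S (j - 1) ^ 2 ∧
    S (2 * j - 1) = 2 * S j * S (j - 1) - X * S (j - 1) ^ 2 ∧
    (X ^ 2 - 4) * derivative (S j) =
      (j : ℤ[X]) * X * S j - (2 * (j : ℤ[X]) + 2) * S (j - 1) ∧
    (X ^ 2 - 4) * derivative (S (j - 1)) =
      2 * (j : ℤ[X]) * S j - ((j : ℤ[X]) + 1) * X * S (j - 1) := by
  have hS_neg_one : S (-1) = 0 := by
    have h := hSrec 0
    simp only [zero_add, zero_sub, hS0, hS1] at h
    linear_combination h
  induction j using Int.induction_on with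
  | zero => simp [hS0, hS_neg_one]
  | succ n ih =>
    generalize (n : ℤ) = k at ih ⊢
    obtain ⟨h1, h2, h3, h4, h5⟩ := ih
    have e1 := hSrec k
    have e2 := hSrec (2 * k)
    have e3 := hSrec (2 * k + 1)
    have d1 := congrArg derivative e1
    simp only [derivative_sub, derivative_mul, derivative_X] at d1
    rw [show 2 * k + 1 - 1 = 2 * k by ring] at e3
    rw [show 2 * (k + 1) - 1 = 2 * k + 1 by ring, show 2 * (k + 1) = 2 * k + 1 + 1 by ring,
      show k + 1 - 1 = k by ring, e3, e2, d1, e1, h2, h3]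
    push_cast
    refine ⟨?_, ?_, ?_, ?_, ?_⟩
    · linear_combination h1
    · ring
    · ring
    · linear_combination X * h4 - h5
    · linear_combination h4
  | pred n ih =>
    generalize (-(n : ℤ)) = k at ih ⊢
    obtain ⟨h1, h2, h3, h4, h5⟩ := ih
    have e1 : S (k - 1 - 1) = X * S (k - 1) - S k := by
      have h := hSrec (k - 1)
      rw [sub_add_cancel] at h
      linear_combination h
    have e2 : S (2 * (k - 1)) = X * S (2 * k - 1) - S (2 * k) := by
      have h := hSrec (2 * k - 1)
      rw [sub_add_cancel, show 2 * k - 1 - 1 = 2 * (k - 1) by ring] at h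
      linear_combination h
    have e3 : S (2 * (k - 1) - 1) = X * S (2 * (k - 1)) - S (2 * k - 1) := by
      have h := hSrec (2 * (k - 1))
      rw [show 2 * (k - 1) + 1 = 2 * k - 1 by ring] at h
      linear_combination h
    have d1 := congrArg derivative e1
    simp only [derivative_sub, derivative_mul, derivative_X] at d1
    rw [e3, e2, d1, e1, h2, h3]
    push_cast
    refine ⟨?_, ?_, ?_, ?_, ?_⟩
    · linear_combination h1
    · ring
    · ring
    · linear_combination h5
    · linear_combination X * h5 - h4

/-- For every integer `j`, the identity
`(ω² − 4)²·H_j = (2j−2)·ω·S_{2j} − (4j+2)·S_{2j−1} + (4j+2)·ω` holds in `ℤ[ω]`, where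
`H_j = S_j″·S_{j−1} − S_{j−1}″·S_j` (second formal derivatives) and `S : ℤ → ℤ[ω]`
satisfies `S 0 = 1`, `S 1 = ω` and `S (j+1) = ω·S j − S (j−1)` for all `j`. -/
theorem statement9 (S : ℤ → Polynomial ℤ)
    (hS0 : S 0 = 1) (hS1 : S 1 = X)
    (hSrec : ∀ j : ℤ, S (j + 1) = X * S j - S (j - 1)) :
    ∀ j : ℤ,
      (X ^ 2 - 4) ^ 2 *
          (derivative (derivative (S j)) * S (j - 1) -
            derivative (derivative (S (j - 1))) * S j) =
        Polynomial.C (2 * j - 2) * X * S (2 * j) - Polynomial.C (4 * j + 2) * S (2 * j - 1) +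
          Polynomial.C (4 * j + 2) * X := by
  intro j
  obtain ⟨h1, h2, h3, h4, h5⟩ := recurrence_invariants S hS0 hS1 hSrec j
  have d4 := congrArg derivative h4
  have d5 := congrArg derivative h5
  simp only [derivative_sub, derivative_add, derivative_mul, derivative_X, derivative_X_pow,
    derivative_intCast, derivative_ofNat, derivative_one] at d4 d5
  rw [h2, h3]
  simp only [map_sub, map_add, map_mul, map_ofNat, eq_intCast] at d4 d5 ⊢
  generalize (j : ℤ[X]) = m at *
  generalize derivative (derivative (S j)) = ddA at *
  generalize derivative (derivative (S (j - 1))) = ddB at *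
  generalize derivative (S j) = dA at *
  generalize derivative (S (j - 1)) = dB at *
  generalize S j = a at *
  generalize S (j - 1) = b at *
  simp only [Nat.cast_ofNat, Nat.add_one_sub_one, pow_one, mul_one, zero_mul, zero_add,
    mul_zero, add_zero, sub_zero] at d4 d5
  linear_combination (X ^ 2 - 4) * b * d4 - (X ^ 2 - 4) * a * d5 +
    ((m - 2) * X * b - 2 * m * a) * h4 +
    (-(2 * m + 2) * b + (m + 3) * X * a) * h5 +
    (4 * m + 2) * X * h1
end

section
/- Let n be a nonzero integer and let F be a field whose characteristic does not divide 2n. Then the image of S_{n−1} in F[ω] is a separable polynomial, and the images of Δ_n and S_{n−1} in F[ω] are coprime, i.e., they generate the unit ideal of F[ω]. -/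
open Polynomial

namespace Polynomial.Chebyshev

theorem eq_S_of_recurrence {R : Type*} [CommRing R] (f : ℤ → R[X]) (h0 : f 0 = 1) (h1 : f 1 = X)
    (hrec : ∀ j : ℤ, f (j + 1) = X * f j - f (j - 1)) (n : ℤ) : f n = S R n := by
  induction n using Chebyshev.induct with
  | zero => simp [h0]
  | one => simp [h1]
  | add_two n ih1 ih2 =>
    have h := hrec (n + 1)
    rw [add_assoc, one_add_one_eq_two, add_sub_cancel_right] at h
    rw [h, ih1, ih2, S_add_two]
  | neg_add_one n ih1 ih2 =>
    have h := hrec (-n)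
    rw [ih1, ih2] at h
    linear_combination h - S_sub_one R (-n)

theorem X_sq_sub_four_mul_derivative_S (R : Type*) [CommRing R] (n : ℤ) :
    (X ^ 2 - 4) * derivative (S R n) =
      (n : R[X]) * X * S R n - 2 * ((n : R[X]) + 1) * S R (n - 1) := by
  induction n using Chebyshev.induct with
  | zero => simp [S_neg_one]
  | one => simp only [Int.cast_one, S_one, sub_self, S_zero, derivative_X]; ring
  | add_two n ih1 ih2 =>
    have e1 : (n : ℤ) + 2 - 1 = n + 1 := by ring
    have e2 : (n : ℤ) + 1 - 1 = n := by ring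
    rw [e2] at ih1
    rw [e1, S_add_two]
    have h := S_add_one R n
    simp only [derivative_sub, derivative_mul, derivative_X]
    push_cast at ih1 ih2 ⊢
    linear_combination X * ih1 - ih2 + 2 * ((n : R[X]) + 1) * h
  | neg_add_one n ih1 ih2 =>
    have e : -(n : ℤ) - 1 - 1 = -n - 2 := by ring
    have e2 : -(n : ℤ) + 1 - 1 = -n := by ring
    rw [e2] at ih2
    have h := S_sub_two R (-n)
    have h1 := S_add_one R (-n)
    have h2 : derivative (S R (-n - 1)) =
        S R (-n) + X * derivative (S R (-n)) - derivative (S R (-n + 1)) := by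
      rw [S_sub_one]; simp [derivative_mul]
    rw [e, h2, h]
    rw [h1] at ih2 ⊢
    push_cast at ih1 ih2 ⊢
    linear_combination X * ih1 - ih2

theorem isCoprime_S_S_sub_one (R : Type*) [CommRing R] (n : ℤ) :
    IsCoprime (S R n) (S R (n - 1)) := by
  have h := S_sq_add_S_sq R (n - 1)
  rw [sub_add_cancel] at h
  exact ⟨S R n - X * S R (n - 1), S R (n - 1), by linear_combination h⟩

theorem separable_S_sub_one {R : Type*} [CommRing R] {n : ℤ} (h : IsUnit (4 * n : R)) :
    (S R (n - 1)).Separable := by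
  obtain ⟨u, hu⟩ := h.exists_left_inv
  replace hu : Polynomial.C u * (4 * (n : R[X])) = 1 := by
    simpa [map_ofNat Polynomial.C 4] using congrArg (Polynomial.C : R → R[X]) hu
  have hd := X_sq_sub_four_mul_derivative_S R (n - 1)
  have hs := S_sq_add_S_sq R (n - 1)
  have hr := S_add_one R (n - 1)
  rw [sub_add_cancel] at hs hr
  push_cast at hd
  set a := S R n
  set b := S R (n - 1)
  refine ⟨Polynomial.C u * ((2 * a - X * b) * X - (n : R[X]) * (X ^ 2 - 4) * b),
    Polynomial.C u * (2 * a - X * b) * (X ^ 2 - 4), ?_⟩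
  linear_combination Polynomial.C u * (2 * a - X * b) * hd +
    4 * (n : R[X]) * Polynomial.C u * hs + hu -
    2 * (n : R[X]) * Polynomial.C u * (2 * a - X * b) * hr

end Polynomial.Chebyshev

/-- Let `n` be a nonzero integer and `F` a field whose characteristic does
not divide `2n`.  Then the image of `S_{n−1}` in `F[ω]` is separable, and the images of
`Δ_n = S_n′·S_{n−1} − S_n·S_{n−1}′` and `S_{n−1}` in `F[ω]` are coprime (generate the unit
ideal).  Here `S : ℤ → ℤ[ω]` satisfies `S 0 = 1`, `S 1 = ω` and
`S (j+1) = ω·S j − S (j−1)` for all `j`. -/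
theorem statement11 (S : ℤ → Polynomial ℤ)
    (hS0 : S 0 = 1) (hS1 : S 1 = X)
    (hSrec : ∀ j : ℤ, S (j + 1) = X * S j - S (j - 1))
    (n : ℤ) (hn : n ≠ 0)
    (F : Type*) [Field F] (hchar : ¬ ((ringChar F : ℤ) ∣ 2 * n)) :
    ((S (n - 1)).map (Int.castRingHom F)).Separable ∧
      IsCoprime
        (((derivative (S n) * S (n - 1) - S n * derivative (S (n - 1))).map
          (Int.castRingHom F)))
        ((S (n - 1)).map (Int.castRingHom F)) := by
  obtain rfl : S = Chebyshev.S ℤ :=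
    funext (Chebyshev.eq_S_of_recurrence S hS0 hS1 hSrec)
  have hunit : IsUnit (4 * n : F) := by
    rw [← CharP.intCast_eq_zero_iff F] at hchar
    push_cast at hchar
    rw [isUnit_iff_ne_zero, show (4 * n : F) = 2 * (2 * n) by ring]
    exact mul_ne_zero (left_ne_zero_of_mul hchar) hchar
  have hsep := Chebyshev.separable_S_sub_one hunit
  simp only [Polynomial.map_sub, Polynomial.map_mul, ← derivative_map, Chebyshev.map_S]
  refine ⟨hsep, ?_⟩
  have hcop := (Chebyshev.isCoprime_S_S_sub_one F n).mul_left (IsCoprime.symm hsep)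
  rw [sub_eq_neg_add]
  exact hcop.neg_left.add_mul_right_left _
end

section
/- Let n be an integer and let p be a prime number dividing 2n+1. Let K be a number field with ring of integers 𝓞_K, let ω ∈ 𝓞_K satisfy Δ_n(ω) = 0, and let 𝔭 be a maximal ideal of 𝓞_K containing p. Then S_{n−1}(ω) ∉ 𝔭. -/
open Polynomial

/-- The two-sided recurrence with its initial values determines the rescaled Chebyshev polynomials
`Polynomial.Chebyshev.S`. -/
theorem eq_chebyshevS_of_recurrence {R : Type*} [CommRing R] {S : ℤ → R[X]} (h0 : S 0 = 1)
    (h1 : S 1 = X) (hrec : ∀ j : ℤ, S (j + 1) = X * S j - S (j - 1)) (n : ℤ) :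
    S n = Chebyshev.S R n := by
  induction n using Chebyshev.induct with
  | zero => simp [h0]
  | one => simp [h1]
  | add_two k ih1 ih0 =>
    have h := hrec (k + 1)
    rw [add_sub_cancel_right, add_assoc, one_add_one_eq_two] at h
    rw [h, ih1, ih0, Chebyshev.S_add_two]
  | neg_add_one k ih0 ih1 =>
    have h := hrec (-k)
    rw [ih0, ih1] at h
    rw [Chebyshev.S_sub_one]
    linear_combination h

/-- The Wronskian of consecutive `S` polynomials, multiplied by `X ^ 2 - 4`. -/
theorem X_sq_sub_four_mul_wronskian_chebyshevS (R : Type*) [CommRing R] (n : ℤ) :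
    (X ^ 2 - 4) * (derivative (Chebyshev.S R n) * Chebyshev.S R (n - 1) -
        Chebyshev.S R n * derivative (Chebyshev.S R (n - 1))) =
      Chebyshev.S R n ^ 2 - Chebyshev.S R (n - 1) ^ 2 - ((2 * n + 1 : ℤ) : R[X]) := by
  have step (k : ℤ) :
      (derivative (Chebyshev.S R (k + 1)) = Chebyshev.S R k + X * derivative (Chebyshev.S R k) -
        derivative (Chebyshev.S R (k - 1))) ∧
      Chebyshev.S R (k - 1) ^ 2 + Chebyshev.S R k ^ 2 -
        X * Chebyshev.S R (k - 1) * Chebyshev.S R k = 1 :=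
    ⟨by rw [Chebyshev.S_add_one]; simp,
      by simpa using Chebyshev.S_sq_add_S_sq R (k - 1)⟩
  induction n using Int.induction_on with
  | zero => simp
  | succ k ih =>
    obtain ⟨hd, hq⟩ := step k
    rw [add_sub_cancel_right, hd, Chebyshev.S_add_one]
    push_cast at ih ⊢
    linear_combination ih - 2 * hq
  | pred k ih =>
    obtain ⟨hd, hq⟩ := step (-k - 1)
    have hs := Chebyshev.S_add_one R (-k - 1)
    rw [sub_add_cancel] at hd hs
    rw [hd, hs] at ih
    push_cast at ih ⊢
    linear_combination ih + 2 * hq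

/-- Let `n` be an integer and `p` a prime dividing `2n+1`.  Let `K` be a
number field with ring of integers `𝓞 K`, let `ω ∈ 𝓞 K` satisfy `Δ_n(ω) = 0` where
`Δ_n = S_n′·S_{n−1} − S_n·S_{n−1}′`, and let `𝔭` be a maximal ideal of `𝓞 K` containing
`p`.  Then `S_{n−1}(ω) ∉ 𝔭`.  Here `S : ℤ → ℤ[ω]` satisfies `S 0 = 1`, `S 1 = ω` and
`S (j+1) = ω·S j − S (j−1)` for all `j`. -/
theorem statement12 (S : ℤ → Polynomial ℤ)
    (hS0 : S 0 = 1) (hS1 : S 1 = X)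
    (hSrec : ∀ j : ℤ, S (j + 1) = X * S j - S (j - 1))
    (n : ℤ) (p : ℕ) (hp : p.Prime) (hpdvd : (p : ℤ) ∣ 2 * n + 1)
    (K : Type*) [Field K] [NumberField K]
    (ω : NumberField.RingOfIntegers K)
    (hΔ : Polynomial.aeval ω
      (derivative (S n) * S (n - 1) - S n * derivative (S (n - 1))) = 0)
    (𝔭 : Ideal (NumberField.RingOfIntegers K)) (h𝔭 : 𝔭.IsMaximal)
    (hp𝔭 : (p : NumberField.RingOfIntegers K) ∈ 𝔭) :
    Polynomial.aeval ω (S (n - 1)) ∉ 𝔭 := by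
  intro hmem
  simp only [eq_chebyshevS_of_recurrence hS0 hS1 hSrec] at hΔ hmem
  have hw := congrArg (aeval ω) (X_sq_sub_four_mul_wronskian_chebyshevS ℤ n)
  rw [map_mul, hΔ, mul_zero] at hw
  simp only [map_sub, map_pow, map_intCast] at hw
  have hq := congrArg (aeval ω) (Chebyshev.S_sq_add_S_sq ℤ (n - 1))
  simp only [sub_add_cancel, map_sub, map_add, map_mul, map_pow, map_one, aeval_X] at hq
  set a := aeval ω (Chebyshev.S ℤ (n - 1))
  set b := aeval ω (Chebyshev.S ℤ n)
  have hdvd : ((2 * n + 1 : ℤ) : NumberField.RingOfIntegers K) ∈ 𝔭 := by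
    obtain ⟨c, hc⟩ := hpdvd
    rw [hc, Int.cast_mul, Int.cast_natCast]
    exact 𝔭.mul_mem_right _ hp𝔭
  have hb : b ∈ 𝔭 := by
    refine h𝔭.isPrime.mem_of_pow_mem 2 ?_
    rw [show b ^ 2 = a * a + ((2 * n + 1 : ℤ) : NumberField.RingOfIntegers K) by
      linear_combination -hw]
    exact 𝔭.add_mem (𝔭.mul_mem_left _ hmem) hdvd
  refine h𝔭.ne_top ((Ideal.eq_top_iff_one 𝔭).2 ?_)
  rw [show (1 : NumberField.RingOfIntegers K) = (a - ω * b) * a + b * b by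
    linear_combination -hq]
  exact 𝔭.add_mem (𝔭.mul_mem_left _ hmem) (𝔭.mul_mem_left _ hb)
end

section
/- Let k = 2m+1 and l = 2n+1 be odd integers with |k| > 1, |l| > 1 and k ≠ l. Then the polynomial F(t,z) = S_n(t)·S_{m−1}(z) − S_{n−1}(t)·S_m(z) in ℂ[t,z] defines a smooth affine curve: there is no point (t₀, z₀) ∈ ℂ² at which F, ∂F/∂t, and ∂F/∂z all vanish simultaneously. -/
open Polynomial

namespace ChebyshevRecurrence

variable {S : ℤ → Polynomial ℤ}

theorem sub_one (hSrec : ∀ j : ℤ, S (j + 1) = X * S j - S (j - 1)) (j : ℤ) :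
    S (j - 1) = X * S j - S (j + 1) := by
  rw [hSrec j]; ring

theorem at_neg_one (hS0 : S 0 = 1) (hS1 : S 1 = X)
    (hSrec : ∀ j : ℤ, S (j + 1) = X * S j - S (j - 1)) : S (-1) = 0 := by
  have h := sub_one hSrec 0
  simpa [hS0, hS1] using h

theorem quadratic_invariant (hS0 : S 0 = 1) (hS1 : S 1 = X)
    (hSrec : ∀ j : ℤ, S (j + 1) = X * S j - S (j - 1)) (j : ℤ) :
    S j ^ 2 + S (j - 1) ^ 2 - X * S j * S (j - 1) = 1 := by
  induction j using Int.induction_on with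
  | zero => simp [hS0, at_neg_one hS0 hS1 hSrec]
  | succ i ih => rw [add_sub_cancel_right, hSrec]; linear_combination ih
  | pred i ih =>
    have h := sub_one hSrec (-(i : ℤ) - 1)
    rw [sub_add_cancel] at h
    rw [h]; linear_combination ih

/-- Reflection about the index `-1`. -/
theorem reflect (hS0 : S 0 = 1) (hS1 : S 1 = X)
    (hSrec : ∀ j : ℤ, S (j + 1) = X * S j - S (j - 1)) (j : ℤ) :
    S (-j - 1) = -S (j - 1) := by
  have key : S (-j - 1) = -S (j - 1) ∧ S (-j - 2) = -S j := by
    have h1 := at_neg_one hS0 hS1 hSrec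
    have h2 := sub_one hSrec (-1)
    norm_num [h1, hS0] at h2
    induction j using Int.induction_on with
    | zero => norm_num [h1, h2, hS0]
    | succ i ih =>
      obtain ⟨ha, hb⟩ := ih
      refine ⟨by rw [show -((i : ℤ) + 1) - 1 = -i - 2 by ring, hb]; simp, ?_⟩
      have h := sub_one hSrec (-(i : ℤ) - 2)
      rw [show -(i : ℤ) - 2 + 1 = -i - 1 by ring, ha, hb] at h
      rw [show -((i : ℤ) + 1) - 2 = -i - 2 - 1 by ring, h, hSrec i]; ring
    | pred i ih =>
      obtain ⟨ha, hb⟩ := ih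
      rw [show -(-(i : ℤ)) - 1 = i - 1 by ring] at ha
      rw [show -(-(i : ℤ)) - 2 = i - 2 by ring] at hb
      refine ⟨?_, by rw [show -(-(i : ℤ) - 1) - 2 = i - 1 by ring, ha]⟩
      have h := hSrec ((i : ℤ) - 1)
      rw [show (i : ℤ) - 1 - 1 = i - 2 by ring, ha, hb] at h
      rw [show -(-(i : ℤ) - 1) - 1 = i - 1 + 1 by ring, h, sub_one hSrec (-(i : ℤ) - 1),
        sub_add_cancel]
      ring
  exact key.1

theorem derivative_formulas (hS0 : S 0 = 1) (hS1 : S 1 = X)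
    (hSrec : ∀ j : ℤ, S (j + 1) = X * S j - S (j - 1)) (j : ℤ) :
    (X ^ 2 - 4) * derivative (S j) = (j : ℤ[X]) * X * S j - 2 * ((j : ℤ[X]) + 1) * S (j - 1) ∧
    (X ^ 2 - 4) * derivative (S (j - 1)) =
      2 * (j : ℤ[X]) * S j - ((j : ℤ[X]) + 1) * X * S (j - 1) := by
  induction j using Int.induction_on with
  | zero => simp [hS0, at_neg_one hS0 hS1 hSrec]
  | succ i ih =>
    obtain ⟨ha, hb⟩ := ih
    rw [add_sub_cancel_right, hSrec]
    simp only [derivative_sub, derivative_mul, derivative_X]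
    push_cast at *
    constructor
    · linear_combination X * ha - hb
    · linear_combination ha
  | pred i ih =>
    obtain ⟨ha, hb⟩ := ih
    have h := sub_one hSrec (-(i : ℤ) - 1)
    rw [sub_add_cancel] at h
    rw [h]
    simp only [derivative_sub, derivative_mul, derivative_X]
    push_cast at *
    constructor
    · linear_combination hb
    · linear_combination X * hb - ha

theorem wronskian_formula (hS0 : S 0 = 1) (hS1 : S 1 = X)
    (hSrec : ∀ j : ℤ, S (j + 1) = X * S j - S (j - 1)) (j : ℤ) :
    (X ^ 2 - 4) * (derivative (S j) * S (j - 1) - S j * derivative (S (j - 1))) =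
      S j ^ 2 - S (j - 1) ^ 2 - ((2 * j + 1 : ℤ) : ℤ[X]) := by
  obtain ⟨ha, hb⟩ := derivative_formulas hS0 hS1 hSrec j
  push_cast
  linear_combination S (j - 1) * ha - S j * hb +
    (2 * (j : ℤ[X]) + 1) * -quadratic_invariant hS0 hS1 hSrec j

theorem monic_and_natDegree (hS0 : S 0 = 1) (hS1 : S 1 = X)
    (hSrec : ∀ j : ℤ, S (j + 1) = X * S j - S (j - 1)) (N : ℕ) :
    (S N).Monic ∧ (S N).natDegree = N := by
  induction N using Nat.twoStepInduction with
  | zero => simp [hS0]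
  | one => simp [hS1, monic_X]
  | more N ih1 ih2 =>
    have h := hSrec ((N : ℤ) + 1)
    rw [add_sub_cancel_right] at h
    push_cast at *
    rw [show (N : ℤ) + 2 = N + 1 + 1 by ring, h]
    have hm : (X * S ((N : ℤ) + 1)).Monic := monic_X.mul ih2.1
    have hd : (X * S ((N : ℤ) + 1)).natDegree = N + 2 := by
      rw [monic_X.natDegree_mul ih2.1, ih2.2, natDegree_X]; ring
    have hlt : (S N).degree < (X * S ((N : ℤ) + 1)).degree := by
      apply degree_lt_degree; rw [hd, ih1.2]; lia
    exact ⟨hm.sub_of_left hlt, by rw [natDegree_sub_eq_left_of_natDegree_lt (by lia), hd]⟩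

/-- `S n ^ 2 - S (n - 1) ^ 2 - c` is monic for `1 ≤ n`, so its zeros are algebraic integers. -/
theorem isIntegral_of_sq_sub_sq (hS0 : S 0 = 1) (hS1 : S 1 = X)
    (hSrec : ∀ j : ℤ, S (j + 1) = X * S j - S (j - 1)) {n : ℤ} (hn : 1 ≤ n) (c : ℤ)
    {t : ℂ}
    (ht : aeval t (S n) ^ 2 - aeval t (S (n - 1)) ^ 2 = c) : IsIntegral ℤ t := by
  obtain ⟨N, rfl⟩ : ∃ N : ℕ, n = (N : ℤ) + 1 := ⟨(n - 1).toNat, by lia⟩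
  rw [add_sub_cancel_right] at ht
  have h1 := monic_and_natDegree hS0 hS1 hSrec N
  have h2 := monic_and_natDegree hS0 hS1 hSrec (N + 1)
  push_cast at h2
  refine ⟨S ((N : ℤ) + 1) ^ 2 - (S N ^ 2 + C c), (h2.1.pow 2).sub_of_left ?_, ?_⟩
  · apply degree_lt_degree
    rw [h2.1.natDegree_pow, h2.2]
    refine (natDegree_add_le _ _).trans_lt ?_
    rw [h1.1.natDegree_pow, h1.2, natDegree_C]
    simp
  · rw [← aeval_def]
    simp only [map_sub, map_add, map_pow, aeval_C]
    linear_combination ht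

theorem one_le_wronskian (hS0 : S 0 = 1) (hS1 : S 1 = X)
    (hSrec : ∀ j : ℤ, S (j + 1) = X * S j - S (j - 1)) (r : ℝ) (N : ℕ) :
    1 ≤ aeval r (derivative (S ((N : ℤ) + 1)) * S N - S ((N : ℤ) + 1) * derivative (S N)) := by
  induction N with
  | zero => simp [hS0, hS1]
  | succ N ih =>
    have h := hSrec ((N : ℤ) + 1)
    rw [add_sub_cancel_right] at h
    push_cast
    have e : derivative (S ((N : ℤ) + 1 + 1)) * S ((N : ℤ) + 1) -
        S ((N : ℤ) + 1 + 1) * derivative (S ((N : ℤ) + 1)) = S ((N : ℤ) + 1) ^ 2 +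
        (derivative (S ((N : ℤ) + 1)) * S N - S ((N : ℤ) + 1) * derivative (S N)) := by
      rw [h]; simp only [derivative_sub, derivative_mul, derivative_X]; ring
    rw [e, map_add, map_pow]
    nlinarith [sq_nonneg (aeval r (S ((N : ℤ) + 1)))]

theorem im_ne_zero_of_wronskian_eq_zero (hS0 : S 0 = 1) (hS1 : S 1 = X)
    (hSrec : ∀ j : ℤ, S (j + 1) = X * S j - S (j - 1)) (N : ℕ) {t : ℂ}
    (ht : aeval t (derivative (S ((N : ℤ) + 1)) * S N - S ((N : ℤ) + 1) * derivative (S N)) = 0) :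
    t.im ≠ 0 := by
  intro him
  have hr : t = algebraMap ℝ ℂ t.re := Complex.ext (by simp) (by simp [him])
  rw [hr, aeval_algebraMap_apply] at ht
  have := one_le_wronskian hS0 hS1 hSrec t.re N
  rw [(map_eq_zero _).mp ht] at this
  norm_num at this

theorem im_mul_conj (hS0 : S 0 = 1) (hS1 : S 1 = X)
    (hSrec : ∀ j : ℤ, S (j + 1) = X * S j - S (j - 1)) (t : ℂ) (N : ℕ) :
    ∃ p : ℝ, 1 ≤ p ∧
      (aeval t (S ((N : ℤ) + 1)) * (starRingEnd ℂ) (aeval t (S N))).im = p * t.im := by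
  induction N with
  | zero => exact ⟨1, le_rfl, by simp [hS0, hS1]⟩
  | succ N ih =>
    obtain ⟨p, hp, h⟩ := ih
    have hr := hSrec ((N : ℤ) + 1)
    rw [add_sub_cancel_right] at hr
    push_cast
    refine ⟨p + Complex.normSq (aeval t (S ((N : ℤ) + 1))),
      by linarith [Complex.normSq_nonneg (aeval t (S ((N : ℤ) + 1)))], ?_⟩
    rw [hr, map_sub, map_mul, aeval_X, Complex.normSq_apply]
    simp only [Complex.mul_im, Complex.sub_im, Complex.sub_re, Complex.mul_re, Complex.conj_re,
      Complex.conj_im] at h ⊢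
    linear_combination h

theorem normSq_lt_of_wronskian_eq_zero (hS0 : S 0 = 1) (hS1 : S 1 = X)
    (hSrec : ∀ j : ℤ, S (j + 1) = X * S j - S (j - 1)) {n : ℤ} (hn : 1 ≤ n) {t : ℂ}
    (ht : aeval t (derivative (S n) * S (n - 1) - S n * derivative (S (n - 1))) = 0) :
    Complex.normSq (aeval t (S (n - 1))) < Complex.normSq (aeval t (S n)) := by
  have hw := congrArg (aeval t) (wronskian_formula hS0 hS1 hSrec n)
  rw [map_mul, ht, mul_zero] at hw
  have hq := congrArg (aeval t) (quadratic_invariant hS0 hS1 hSrec n)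
  obtain ⟨N, rfl⟩ : ∃ N : ℕ, n = (N : ℤ) + 1 := ⟨(n - 1).toNat, by lia⟩
  rw [add_sub_cancel_right] at *
  have him := im_ne_zero_of_wronskian_eq_zero hS0 hS1 hSrec N ht
  obtain ⟨p, hp, hp'⟩ := im_mul_conj hS0 hS1 hSrec t N
  simp only [map_sub, map_add, map_mul, map_pow, aeval_X, map_one, map_intCast] at hw hq
  generalize aeval t (S ((N : ℤ) + 1)) = x at *
  generalize aeval t (S (N : ℤ)) = y at *
  set l : ℝ := 2 * N + 3 with hl
  have hlc : (((2 * ((N : ℤ) + 1) + 1 : ℤ)) : ℂ) = (l : ℂ) := by rw [hl]; push_cast; ring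
  rw [hlc] at hw
  have hl3 : 3 ≤ l := by rw [hl]; linarith [(Nat.cast_nonneg N : (0 : ℝ) ≤ N)]
  have key : (l : ℂ) * t * (Complex.normSq x * Complex.normSq y : ℝ) =
      ((l - 1) * Complex.normSq x : ℝ) * (x * (starRingEnd ℂ) y) +
      ((l + 1) * Complex.normSq y : ℝ) * (starRingEnd ℂ) (x * (starRingEnd ℂ) y) := by
    push_cast
    rw [map_mul, Complex.conj_conj, ← Complex.mul_conj, ← Complex.mul_conj]
    linear_combination (-(l : ℂ) * hq - hw) * ((starRingEnd ℂ) x * (starRingEnd ℂ) y)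
  have key2 := congrArg Complex.im key
  rw [Complex.add_im, Complex.im_ofReal_mul, Complex.im_ofReal_mul, Complex.conj_im, hp',
    Complex.im_mul_ofReal, Complex.im_ofReal_mul] at key2
  have key3 : l * (Complex.normSq x * Complex.normSq y) =
      p * ((l - 1) * Complex.normSq x - (l + 1) * Complex.normSq y) := by
    apply mul_left_cancel₀ him; linear_combination key2
  have hx := Complex.normSq_nonneg x
  have hy := Complex.normSq_nonneg y
  have h4 : 0 ≤ (l - 1) * Complex.normSq x - (l + 1) * Complex.normSq y := by
    have : 0 ≤ l * (Complex.normSq x * Complex.normSq y) := by positivity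
    rw [key3] at this
    exact nonneg_of_mul_nonneg_right this (by linarith)
  by_contra! hle
  have hy0 : Complex.normSq y = 0 := by nlinarith
  have hx0 : Complex.normSq x = 0 := by linarith
  rw [Complex.normSq_eq_zero] at hx0 hy0
  rw [hx0, hy0] at hw
  have : (l : ℂ) = 0 := by linear_combination hw
  rw [Complex.ofReal_eq_zero] at this
  linarith

theorem isIntegral_of_wronskian_eq_zero (hS0 : S 0 = 1) (hS1 : S 1 = X)
    (hSrec : ∀ j : ℤ, S (j + 1) = X * S j - S (j - 1)) {n : ℤ} (hn : 1 < |2 * n + 1|) {t : ℂ}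
    (ht : aeval t (derivative (S n) * S (n - 1) - S n * derivative (S (n - 1))) = 0) :
    IsIntegral ℤ t := by
  have hw := congrArg (aeval t) (wronskian_formula hS0 hS1 hSrec n)
  rw [map_mul, ht, mul_zero] at hw
  simp only [map_sub, map_pow, map_intCast] at hw
  rcases lt_abs.mp hn with h | h
  · exact isIntegral_of_sq_sub_sq hS0 hS1 hSrec (n := n) (by lia) (2 * n + 1)
      (by linear_combination -hw)
  · refine isIntegral_of_sq_sub_sq hS0 hS1 hSrec (n := -n - 1) (by lia) (-(2 * n + 1)) ?_
    have h1 := reflect hS0 hS1 hSrec (n + 1)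
    rw [show -(n + 1) - 1 = -n - 1 - 1 by ring, add_sub_cancel_right] at h1
    rw [h1, reflect hS0 hS1 hSrec n, map_neg, map_neg]
    push_cast at *
    linear_combination hw

theorem normSq_lt_of_wronskian_eq_zero_of_le (hS0 : S 0 = 1) (hS1 : S 1 = X)
    (hSrec : ∀ j : ℤ, S (j + 1) = X * S j - S (j - 1)) {n : ℤ} (hn : n ≤ -2) {t : ℂ}
    (ht : aeval t (derivative (S n) * S (n - 1) - S n * derivative (S (n - 1))) = 0) :
    Complex.normSq (aeval t (S n)) < Complex.normSq (aeval t (S (n - 1))) := by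
  have h1 := reflect hS0 hS1 hSrec (n + 1)
  rw [show -(n + 1) - 1 = -n - 1 - 1 by ring, add_sub_cancel_right] at h1
  have h2 := reflect hS0 hS1 hSrec n
  have h := normSq_lt_of_wronskian_eq_zero hS0 hS1 hSrec (n := -n - 1) (t := t) (by lia) (by
    rw [h1, h2, ← neg_eq_zero, ← map_neg, ← ht]
    congr 1
    simp only [derivative_neg]; ring)
  simpa only [h1, h2, map_neg, Complex.normSq_neg] using h

theorem isIntegral_aeval {t : ℂ} (ht : IsIntegral ℤ t) (p : ℤ[X]) :
    IsIntegral ℤ (aeval t p) :=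
  adjoin_le_integralClosure ht (aeval_mem_adjoin_singleton ℤ t)

theorem dvd_of_isIntegral_mul_eq {a b : ℤ} (ha : a ≠ 0) {e : ℂ} (he : IsIntegral ℤ e)
    (h : e * a = b) : a ∣ b := by
  have ha' : (a : ℂ) ≠ 0 := by exact_mod_cast ha
  have e1 : e = algebraMap ℚ ℂ ((b : ℚ) / a) := by
    rw [eq_div_of_mul_eq ha' h]; simp
  rw [e1, isIntegral_algebraMap_iff (algebraMap ℚ ℂ).injective] at he
  obtain ⟨c, hc⟩ := IsIntegrallyClosed.isIntegral_iff.mp he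
  refine ⟨c, ?_⟩
  have ha'' : (a : ℚ) ≠ 0 := by exact_mod_cast ha
  rw [eq_intCast, eq_div_iff ha''] at hc
  rw [mul_comm]; exact_mod_cast hc.symm

end ChebyshevRecurrence

theorem MvPolynomial.eval_aeval_X {σ : Type*} (v : σ → ℂ) (i : σ) (p : ℤ[X]) :
    MvPolynomial.eval v (Polynomial.aeval (MvPolynomial.X i) p) = Polynomial.aeval (v i) p := by
  have h := Polynomial.map_aeval_eq_aeval_map (S := MvPolynomial σ ℂ) (T := ℤ) (U := ℂ)
    (φ := RingHom.id ℤ) (ψ := MvPolynomial.eval v) (RingHom.ext_int _ _) p (MvPolynomial.X i)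
  simpa using h

theorem MvPolynomial.pderiv_aeval_X {σ : Type*} (i j : σ) (p : ℤ[X]) :
    MvPolynomial.pderiv j (Polynomial.aeval (MvPolynomial.X i : MvPolynomial σ ℂ) p) =
      Polynomial.aeval (MvPolynomial.X i) (derivative p) *
        MvPolynomial.pderiv j (MvPolynomial.X i) :=
  ((MvPolynomial.pderiv (R := ℂ) j).restrictScalars ℤ).map_aeval p (MvPolynomial.X i)

/-- Let `k = 2m+1` and `l = 2n+1` be odd integers with `|k| > 1`, `|l| > 1`
and `k ≠ l`.  Then the polynomial `F(t,z) = S_n(t)·S_{m−1}(z) − S_{n−1}(t)·S_m(z)` in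
`ℂ[t,z]` (with `t` the variable `X 0` and `z` the variable `X 1`) defines a smooth affine
curve: there is no point `(t₀, z₀) ∈ ℂ²` at which `F`, `∂F/∂t` and `∂F/∂z` all vanish.
Here `S : ℤ → ℤ[ω]` satisfies `S 0 = 1`, `S 1 = ω` and `S (j+1) = ω·S j − S (j−1)`
for all `j`. -/
theorem statement13 (S : ℤ → Polynomial ℤ)
    (hS0 : S 0 = 1) (hS1 : S 1 = X)
    (hSrec : ∀ j : ℤ, S (j + 1) = X * S j - S (j - 1))
    (m n : ℤ) (hk : 1 < |2 * m + 1|) (hl : 1 < |2 * n + 1|)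
    (hne : 2 * m + 1 ≠ 2 * n + 1)
    (F : MvPolynomial (Fin 2) ℂ)
    (hF : F = Polynomial.aeval (MvPolynomial.X 0) (S n) *
          Polynomial.aeval (MvPolynomial.X 1) (S (m - 1)) -
        Polynomial.aeval (MvPolynomial.X 0) (S (n - 1)) *
          Polynomial.aeval (MvPolynomial.X 1) (S m)) :
    ¬ ∃ t₀ z₀ : ℂ,
      MvPolynomial.eval ![t₀, z₀] F = 0 ∧
      MvPolynomial.eval ![t₀, z₀] (MvPolynomial.pderiv 0 F) = 0 ∧
      MvPolynomial.eval ![t₀, z₀] (MvPolynomial.pderiv 1 F) = 0 := by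
  rintro ⟨t, z, hF0, hFt, hFz⟩
  subst hF
  simp only [map_sub, Derivation.leibniz, MvPolynomial.pderiv_aeval_X, map_mul, smul_eq_mul,
    MvPolynomial.eval_aeval_X, MvPolynomial.pderiv_X_self, MvPolynomial.pderiv_X_of_ne,
    ne_eq, zero_ne_one, one_ne_zero, not_false_eq_true, mul_zero, mul_one,
    add_zero, zero_add, Matrix.cons_val_zero, Matrix.cons_val_one] at hF0 hFt hFz
  have qn := congrArg (aeval t) (ChebyshevRecurrence.quadratic_invariant hS0 hS1 hSrec n)
  have qm := congrArg (aeval z) (ChebyshevRecurrence.quadratic_invariant hS0 hS1 hSrec m)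
  have wn := congrArg (aeval t) (ChebyshevRecurrence.wronskian_formula hS0 hS1 hSrec n)
  have wm := congrArg (aeval z) (ChebyshevRecurrence.wronskian_formula hS0 hS1 hSrec m)
  simp only [map_sub, map_add, map_mul, map_pow, aeval_X, map_one, map_intCast] at qn qm wn wm
  obtain ⟨e, he⟩ : ∃ e, e = (aeval t (S n) - t * aeval t (S (n - 1))) * aeval z (S m) +
    aeval t (S (n - 1)) * aeval z (S (m - 1)) := ⟨_, rfl⟩
  obtain ⟨d, hd⟩ : ∃ d, d = (aeval z (S m) - z * aeval z (S (m - 1))) * aeval t (S n) +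
    aeval z (S (m - 1)) * aeval t (S (n - 1)) := ⟨_, rfl⟩
  have hU : aeval z (S m) = e * aeval t (S n) := by
    rw [he]; linear_combination -aeval z (S m) * qn - aeval t (S (n - 1)) * hF0
  have hV : aeval z (S (m - 1)) = e * aeval t (S (n - 1)) := by
    rw [he]
    linear_combination -aeval z (S (m - 1)) * qn +
      (aeval t (S n) - t * aeval t (S (n - 1))) * hF0
  have hed : e * d = 1 := by
    rw [hd, ← qm]
    linear_combination (-(aeval z (S m) - z * aeval z (S (m - 1)))) * hU - aeval z (S (m - 1)) * hV
  have he0 : e ≠ 0 := left_ne_zero_of_mul_eq_one hed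
  have ht : aeval t (derivative (S n) * S (n - 1) - S n * derivative (S (n - 1))) = 0 := by
    apply mul_left_cancel₀ he0
    rw [hU, hV] at hFt
    simp only [map_sub, map_mul]
    linear_combination hFt
  have hz : aeval z (derivative (S m) * S (m - 1) - S m * derivative (S (m - 1))) = 0 := by
    simp only [map_sub, map_mul]
    linear_combination aeval z (derivative (S m)) * hV - aeval z (derivative (S (m - 1))) * hU
      - e * hFz
  have it := ChebyshevRecurrence.isIntegral_of_wronskian_eq_zero hS0 hS1 hSrec hl ht
  have iz := ChebyshevRecurrence.isIntegral_of_wronskian_eq_zero hS0 hS1 hSrec hk hz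
  have ait := fun p => ChebyshevRecurrence.isIntegral_aeval it p
  have aiz := fun p => ChebyshevRecurrence.isIntegral_aeval iz p
  have ie : IsIntegral ℤ e := by
    rw [he]
    exact (((ait _).sub (it.mul (ait _))).mul (aiz _)).add
      ((ait _).mul (aiz _))
  have id : IsIntegral ℤ d := by
    rw [hd]
    exact (((aiz _).sub (iz.mul (aiz _))).mul (ait _)).add
      ((aiz _).mul (ait _))
  simp only [map_sub, map_mul] at ht hz
  rw [ht, mul_zero] at wn
  rw [hz, mul_zero, hU, hV] at wm
  have hkl : e ^ 2 * ((2 * n + 1 : ℤ) : ℂ) = ((2 * m + 1 : ℤ) : ℂ) := by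
    linear_combination e ^ 2 * wn - wm
  have hlk : d ^ 2 * ((2 * m + 1 : ℤ) : ℂ) = ((2 * n + 1 : ℤ) : ℂ) := by
    rw [← hkl]; linear_combination ((2 * n + 1 : ℤ) : ℂ) * (e * d + 1) * hed
  have h1 := ChebyshevRecurrence.dvd_of_isIntegral_mul_eq (by lia) (ie.pow 2) hkl
  have h2 := ChebyshevRecurrence.dvd_of_isIntegral_mul_eq (by lia) (id.pow 2) hlk
  have hmn : m = -n - 1 := by
    rcases Int.natAbs_eq_natAbs_iff.mp (Int.natAbs_eq_of_dvd_dvd h1 h2) with h | h <;> lia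
  rw [← map_mul, ← map_mul, ← map_sub] at ht hz
  have hpos := Complex.normSq_nonneg e
  rcases lt_abs.mp hl with h | h
  · have a := ChebyshevRecurrence.normSq_lt_of_wronskian_eq_zero hS0 hS1 hSrec (by lia) ht
    have b := ChebyshevRecurrence.normSq_lt_of_wronskian_eq_zero_of_le hS0 hS1 hSrec (by lia) hz
    rw [hU, hV, map_mul, map_mul] at b
    exact (mul_le_mul_of_nonneg_left a.le hpos).not_gt b
  · have a := ChebyshevRecurrence.normSq_lt_of_wronskian_eq_zero_of_le hS0 hS1 hSrec (by lia) ht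
    have b := ChebyshevRecurrence.normSq_lt_of_wronskian_eq_zero hS0 hS1 hSrec (by lia) hz
    rw [hU, hV, map_mul, map_mul] at b
    exact (mul_le_mul_of_nonneg_left a.le hpos).not_gt b
end

section
/- Let l = 2n+1 be an odd integer with |l| > 3, and let F(t,z) = S_n(t)·S_{n−1}(z) − S_{n−1}(t)·S_n(z) in ℂ[t,z]. Then F = (t − z)·G for a polynomial G ∈ ℂ[t,z] that is irreducible and not divisible by (t − z); in particular, F has exactly two distinct irreducible factors up to units, namely t − z and G. -/
open Polynomial

namespace Polynomial

section Resultant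

variable {K : Type*} [Field K]

lemma resultant_ne_zero_of_isCoprime_of_coeff_left {f g : K[X]} {m n : ℕ}
    (hf : f.natDegree ≤ m) (hg : g.natDegree ≤ n) (hm : f.coeff m ≠ 0) (h : IsCoprime f g) :
    resultant f g m n ≠ 0 := by
  obtain rfl : f.natDegree = m := le_antisymm hf (le_natDegree_of_ne_zero hm)
  obtain ⟨k, rfl⟩ := Nat.exists_eq_add_of_le hg
  rw [resultant_add_right_deg _ _ _ _ _ le_rfl]
  exact mul_ne_zero (pow_ne_zero _ hm) (resultant_ne_zero f g h)

lemma resultant_ne_zero_of_isCoprime_of_coeff {f g : K[X]} {m n : ℕ}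
    (hf : f.natDegree ≤ m) (hg : g.natDegree ≤ n) (hmn : f.coeff m ≠ 0 ∨ g.coeff n ≠ 0)
    (h : IsCoprime f g) : resultant f g m n ≠ 0 := by
  rcases hmn with hm | hn
  · exact resultant_ne_zero_of_isCoprime_of_coeff_left hf hg hm h
  · rw [resultant_comm]
    exact mul_ne_zero (pow_ne_zero _ (by simp))
      (resultant_ne_zero_of_isCoprime_of_coeff_left hg hf hn h.symm)

end Resultant

namespace Bivariate

lemma coeff_coeff_swap {R : Type*} [CommSemiring R] (A : R[X][Y]) (i j : ℕ) :
    ((swap A).coeff j).coeff i = (A.coeff i).coeff j := by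
  induction A using Polynomial.induction_on' with
  | add p q hp hq => simp [hp, hq]
  | monomial n f =>
    induction f using Polynomial.induction_on' with
    | add p q hp hq => simp_all
    | monomial m r =>
      rw [swap_monomial_monomial]
      simp only [coeff_monomial]
      split_ifs <;> simp_all [coeff_monomial]

lemma natDegree_coeff_swap_le {R : Type*} [CommSemiring R] (A : R[X][Y]) (j : ℕ) :
    ((swap A).coeff j).natDegree ≤ A.natDegree := by
  refine natDegree_le_iff_coeff_eq_zero.2 fun i hi ↦ ?_
  rw [coeff_coeff_swap, coeff_eq_zero_of_natDegree_lt hi, coeff_zero]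

lemma map_evalRingHom_eq_eval_swap {R : Type*} [CommRing R] (A : R[X][Y]) (x : R) :
    A.map (evalRingHom x) = (swap A).eval (C x) := by
  induction A using Polynomial.induction_on' with
  | add p q hp hq => simp [hp, hq]
  | monomial n f =>
    rw [swap_monomial, eval_mul, eval_map_apply, eval_C, map_monomial, coe_evalRingHom,
      C_mul_X_pow_eq_monomial]

/-- The polynomial `t ^ d * A (t⁻¹, Y)`, where `d` is the degree of `A` in its first variable. -/
noncomputable def reverseX {R : Type*} [CommSemiring R] (A : R[X][Y]) : R[X][Y] :=
  swap (reverse (swap A))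

lemma map_evalRingHom_zero_reverseX {R : Type*} [CommRing R] (A : R[X][Y]) :
    (reverseX A).map (evalRingHom 0) = (swap A).leadingCoeff := by
  rw [map_evalRingHom_eq_eval_swap, reverseX, swap_swap_apply, C_0, ← coeff_zero_eq_eval_zero,
    coeff_zero_reverse]

lemma map_evalRingHom_reverseX {K : Type*} [Field K] (A : K[X][Y]) {x : K} (hx : x ≠ 0) :
    (reverseX A).map (evalRingHom x) =
      C (x ^ (swap A).natDegree) * A.map (evalRingHom x⁻¹) := by
  rw [map_evalRingHom_eq_eval_swap, map_evalRingHom_eq_eval_swap, reverseX, swap_swap_apply]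
  let _ : Invertible (C x⁻¹ : K[X]) :=
    ⟨C x, by rw [← C_mul, mul_inv_cancel₀ hx, C_1], by rw [← C_mul, inv_mul_cancel₀ hx, C_1]⟩
  have h : eval (C x) (reverse (swap A)) * C x⁻¹ ^ (swap A).natDegree = eval (C x⁻¹) (swap A) :=
    eval₂_reverse_mul_pow (RingHom.id K[X]) (C x⁻¹) (swap A)
  rw [← h, mul_left_comm, ← C_pow, ← C_mul, ← mul_pow, mul_inv_cancel₀ hx, one_pow, C_1, mul_one]

/-- Two curves in `ℙ¹ × ℙ¹` with positive intersection number and no common point at infinity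
meet in the affine plane. -/
theorem exists_evalEval_eq_zero {K : Type*} [Field K] [IsAlgClosed K] (A B : K[X][Y])
    (hY : IsCoprime A.leadingCoeff B.leadingCoeff)
    (hX : IsCoprime (swap A).leadingCoeff (swap B).leadingCoeff)
    (hdeg : (swap A).leadingCoeff.natDegree = A.natDegree)
    (hA : A ≠ 0)
    (hpos : (swap A).natDegree * B.natDegree + (swap B).natDegree * A.natDegree ≠ 0) :
    ∃ x y, A.evalEval x y = 0 ∧ B.evalEval x y = 0 := by
  by_contra! hne
  have hR (x : K) : (resultant A B).eval x ≠ 0 := by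
    rw [← coe_evalRingHom, ← resultant_map_map]
    refine resultant_ne_zero_of_isCoprime_of_coeff natDegree_map_le natDegree_map_le ?_ ?_
    · simpa using (isCoprime_iff_aeval_ne_zero_of_isAlgClosed K K _ _).1 hY x
    · refine (isCoprime_iff_aeval_ne_zero_of_isAlgClosed K K _ _).2 fun y ↦ ?_
      simp only [coe_aeval_eq_eval, map_evalRingHom_eval]
      exact or_iff_not_imp_left.2 fun h ↦ hne x y (not_not.1 h)
  obtain ⟨c, hc⟩ : ∃ c, resultant A B = C c := by
    refine ⟨_, eq_C_of_degree_eq_zero ?_⟩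
    by_contra hd
    obtain ⟨x, hx⟩ := IsAlgClosed.exists_root _ hd
    exact hR x hx
  set k := (swap A).natDegree * B.natDegree + (swap B).natDegree * A.natDegree with hk
  have hrev : resultant (reverseX A) (reverseX B) A.natDegree B.natDegree = C c * X ^ k := by
    refine eq_of_infinite_eval_eq _ _ ((Set.finite_singleton (0 : K)).infinite_compl.mono ?_)
    intro x hx
    have hx : x ≠ 0 := hx
    have hx' : (resultant A B).eval x⁻¹ = c := by rw [hc, eval_C]
    simp only [Set.mem_ofPred_eq, eval_mul, eval_C, eval_pow, eval_X]
    rw [← coe_evalRingHom, ← resultant_map_map, map_evalRingHom_reverseX A hx,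
      map_evalRingHom_reverseX B hx, resultant_C_mul_left, resultant_C_mul_right,
      resultant_map_map, coe_evalRingHom, hx', hk, pow_add, pow_mul, pow_mul]
    ring
  have h0 := congrArg (evalRingHom (0 : K)) hrev
  rw [← resultant_map_map, map_evalRingHom_zero_reverseX, map_evalRingHom_zero_reverseX] at h0
  refine resultant_ne_zero_of_isCoprime_of_coeff_left (natDegree_coeff_swap_le A _)
    (natDegree_coeff_swap_le B _) ?_ hX (h0.trans ?_)
  · change (swap A).leadingCoeff.coeff _ ≠ 0
    rw [← hdeg]
    simpa using hA
  · simp [hpos]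

open _root_.Polynomial.Chebyshev (S S_add_two S_sq_add_S_sq)

/-- The Christoffel–Darboux kernel of the polynomials `S j`. -/
noncomputable def kernelS (N : ℕ) : ℂ[X][Y] :=
  ∑ j ∈ Finset.range (N + 1), C (S ℂ j) * (S ℂ j).map C

lemma kernelS_succ (N : ℕ) :
    kernelS (N + 1) = kernelS N + C (S ℂ (N + 1)) * (S ℂ (N + 1)).map C := by
  rw [kernelS, Finset.sum_range_succ, ← kernelS]
  push_cast
  rfl

lemma sub_mul_kernelS (N : ℕ) :
    (C X - Y) * kernelS N = C (S ℂ (N + 1)) * (S ℂ N).map C - C (S ℂ N) * (S ℂ (N + 1)).map C := by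
  induction N with
  | zero => simp [kernelS]
  | succ N ih =>
    rw [kernelS_succ, mul_add, ih]
    push_cast
    rw [show (N : ℤ) + 1 + 1 = N + 2 by ring, S_add_two]
    simp only [C_sub, C_mul, Polynomial.map_sub, Polynomial.map_mul, Polynomial.map_X]
    ring

lemma swap_kernelS (N : ℕ) : swap (kernelS N) = kernelS N := by
  simp only [kernelS, map_sum, map_mul, swap_C, swap_map_C]
  exact Finset.sum_congr rfl fun _ _ ↦ mul_comm _ _

lemma monic_and_natDegree_S (N : ℕ) : (S ℂ N).Monic ∧ (S ℂ N).natDegree = N := by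
  induction N using Nat.twoStepInduction with
  | zero => simp
  | one => simp [monic_X]
  | more N ih₀ ih₁ =>
    have hS : S ℂ ((N + 2 : ℕ) : ℤ) = X * S ℂ (N + 1 : ℕ) - S ℂ N := by
      push_cast
      exact S_add_two ℂ N
    have hm : (X * S ℂ (N + 1 : ℕ)).Monic := monic_X.mul ih₁.1
    have hd : (X * S ℂ (N + 1 : ℕ)).natDegree = N + 2 := by
      rw [natDegree_X_mul ih₁.1.ne_zero, ih₁.2]
    have hlt : (S ℂ N).degree < (X * S ℂ (N + 1 : ℕ)).degree := by
      rw [degree_eq_natDegree hm.ne_zero, degree_eq_natDegree ih₀.1.ne_zero, hd, ih₀.2]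
      exact_mod_cast (by lia : N < N + 2)
    rw [hS]
    refine ⟨hm.sub_of_left hlt, ?_⟩
    rw [natDegree_sub_eq_left_of_natDegree_lt (by rw [hd, ih₀.2]; lia), hd]

lemma natDegree_kernelS_le (N : ℕ) : (kernelS N).natDegree ≤ N := by
  refine natDegree_sum_le_of_forall_le _ _ fun j hj ↦ (natDegree_C_mul_le _ _).trans ?_
  rw [natDegree_map_eq_of_injective (C_injective), (monic_and_natDegree_S j).2]
  exact Finset.mem_range_succ_iff.1 hj

lemma coeff_kernelS (N : ℕ) : (kernelS N).coeff N = S ℂ N := by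
  have h : (S ℂ N).coeff N = 1 := by
    simpa [Monic, leadingCoeff, (monic_and_natDegree_S N).2] using (monic_and_natDegree_S N).1
  cases N with
  | zero => simp [kernelS]
  | succ N =>
    rw [kernelS_succ, coeff_add,
      coeff_eq_zero_of_natDegree_lt ((natDegree_kernelS_le N).trans_lt N.lt_succ_self)]
    rw [coeff_C_mul, coeff_map]
    push_cast at h ⊢
    rw [h]
    simp

lemma natDegree_kernelS (N : ℕ) : (kernelS N).natDegree = N :=
  le_antisymm (natDegree_kernelS_le N) <| le_natDegree_of_ne_zero <| by
    rw [coeff_kernelS]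
    exact (monic_and_natDegree_S N).1.ne_zero

lemma leadingCoeff_kernelS (N : ℕ) : (kernelS N).leadingCoeff = S ℂ N := by
  rw [leadingCoeff, natDegree_kernelS, coeff_kernelS]

lemma kernelS_ne_zero (N : ℕ) : kernelS N ≠ 0 := by
  rw [← leadingCoeff_ne_zero, leadingCoeff_kernelS]
  exact (monic_and_natDegree_S N).1.ne_zero

/-- On the diagonal, the Christoffel–Darboux kernel is a Wronskian. -/
lemma eval_X_kernelS (N : ℕ) :
    (kernelS N).eval X =
      derivative (S ℂ (N + 1)) * S ℂ N - S ℂ (N + 1) * derivative (S ℂ N) := by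
  have hmap (p : ℂ[X]) : (p.map C).eval X = p := by
    rw [eval_map, eval₂_C_X]
  induction N with
  | zero => simp [kernelS]
  | succ N ih =>
    rw [kernelS_succ, eval_add, ih, eval_mul, eval_C, hmap]
    push_cast
    rw [show (N : ℤ) + 1 + 1 = N + 2 by ring, S_add_two]
    simp only [derivative_sub, derivative_mul, derivative_X]
    ring

lemma mul_eval_X_kernelS (N : ℕ) :
    (X ^ 2 - 4) * (kernelS N).eval X = S ℂ (N + 1) ^ 2 - S ℂ N ^ 2 - (2 * N + 3 : ℂ[X]) := by
  induction N with
  | zero => simp [kernelS]; ring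
  | succ N ih =>
    have hmap : ((S ℂ (N + 1)).map C).eval X = S ℂ (N + 1) := by
      rw [eval_map, eval₂_C_X]
    have h := S_sq_add_S_sq ℂ N
    rw [kernelS_succ, eval_add, mul_add, ih, eval_mul, eval_C, hmap]
    push_cast
    rw [show (N : ℤ) + 1 + 1 = N + 2 by ring, S_add_two]
    linear_combination (-2) * h

section Critical

variable {N : ℕ} {x : ℂ}

lemma eval_S_sq (N : ℕ) (x : ℂ) :
    (S ℂ N).eval x ^ 2 + (S ℂ (N + 1)).eval x ^ 2
      - x * (S ℂ N).eval x * (S ℂ (N + 1)).eval x = 1 := by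
  simpa using congrArg (eval x) (S_sq_add_S_sq ℂ N)

lemma eval_S_sq_sub (h : ((kernelS N).eval X).eval x = 0) :
    (S ℂ (N + 1)).eval x ^ 2 - (S ℂ N).eval x ^ 2 = 2 * N + 3 := by
  have := congrArg (eval x) (mul_eval_X_kernelS N)
  rw [eval_mul, h] at this
  simp only [mul_zero, eval_sub, eval_pow, eval_add, eval_mul, eval_natCast, eval_ofNat] at this
  linear_combination -this

lemma eval_S_ne_zero (h : ((kernelS N).eval X).eval x = 0) :
    (S ℂ N).eval x ≠ 0 ∧ (S ℂ (N + 1)).eval x ≠ 0 := by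
  have h₁ := eval_S_sq_sub h
  have h₂ := eval_S_sq N x
  constructor <;> intro h₀ <;> rw [h₀] at h₁ h₂
  · have : ((2 * N + 2 : ℕ) : ℂ) = 0 := by push_cast; linear_combination h₂ - h₁
    norm_cast at this
  · have : ((2 * N + 4 : ℕ) : ℂ) = 0 := by push_cast; linear_combination -h₂ - h₁
    norm_cast at this

lemma eval_S_ne_zero_or (N : ℕ) (x : ℂ) : (S ℂ N).eval x ≠ 0 ∨ (S ℂ (N + 1)).eval x ≠ 0 := by
  by_contra! h
  simpa [h.1, h.2] using eval_S_sq N x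

/-- The zeros of `S N` are simple. -/
lemma eval_derivative_S_ne_zero (h : (S ℂ N).eval x = 0) : (derivative (S ℂ N)).eval x ≠ 0 := by
  intro h'
  refine (eval_S_ne_zero (N := N) (x := x) ?_).1 h
  simp [eval_X_kernelS, h, h']

/-- The critical points of `S (N + 1) / S N` are simple. -/
lemma eval_derivative_kernelS_ne_zero (h : ((kernelS N).eval X).eval x = 0) :
    (derivative ((kernelS N).eval X)).eval x ≠ 0 := by
  intro h'
  have h₁ := congrArg (fun p ↦ (derivative p).eval x) (mul_eval_X_kernelS N)
  have h₂ := congrArg (fun p ↦ (derivative p).eval x) (S_sq_add_S_sq ℂ N)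
  have h₃ := eval_S_sq_sub h
  have h₄ := h
  rw [eval_X_kernelS] at h₄
  obtain ⟨hb, ha⟩ := eval_S_ne_zero h
  simp only [derivative_mul, derivative_sub, derivative_add, derivative_pow, derivative_X,
    derivative_one, derivative_natCast, derivative_ofNat, eval_add, eval_sub, eval_mul, eval_pow,
    eval_X, eval_zero, eval_one, eval_C, eval_natCast, eval_ofNat, h, h'] at h₁ h₂ h₄
  set a := (S ℂ (N + 1)).eval x
  set b := (S ℂ N).eval x
  set a' := (derivative (S ℂ (N + 1))).eval x
  set b' := (derivative (S ℂ N)).eval x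
  have hl : (2 * N + 3 : ℂ) ≠ 0 := by exact_mod_cast (by lia : 2 * N + 3 ≠ 0)
  have ha' : a' = 0 := by
    refine (mul_eq_zero.1 (?_ : (2 * N + 3 : ℂ) * a' = 0)).resolve_left hl
    linear_combination -a' * h₃ - a / 2 * h₁ - b * h₄
  have hb' : b' = 0 := by
    refine (mul_eq_zero.1 (?_ : (2 * N + 3 : ℂ) * b' = 0)).resolve_left hl
    linear_combination -b' * h₃ - b / 2 * h₁ - a * h₄
  refine mul_ne_zero hb ha ?_
  rw [ha', hb'] at h₂
  linear_combination -h₂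

/-- The critical values of `S (N + 1) / S N` are distinct. -/
lemma eq_of_critical {y : ℂ} (hx : ((kernelS N).eval X).eval x = 0)
    (hy : ((kernelS N).eval X).eval y = 0)
    (hxy : (S ℂ (N + 1)).eval x * (S ℂ N).eval y = (S ℂ N).eval x * (S ℂ (N + 1)).eval y) :
    x = y := by
  have hx₁ := eval_S_sq_sub hx
  have hy₁ := eval_S_sq_sub hy
  have hx₂ := eval_S_sq N x
  have hy₂ := eval_S_sq N y
  obtain ⟨hxb, hxa⟩ := eval_S_ne_zero hx
  obtain ⟨hyb, hya⟩ := eval_S_ne_zero hy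
  set a := (S ℂ (N + 1)).eval x
  set b := (S ℂ N).eval x
  set a' := (S ℂ (N + 1)).eval y
  set b' := (S ℂ N).eval y
  have hl : (2 * N + 3 : ℂ) ≠ 0 := by exact_mod_cast (by lia : 2 * N + 3 ≠ 0)
  have hbb : b ^ 2 = b' ^ 2 := by
    refine mul_left_cancel₀ hl ?_
    linear_combination -(a * b' + b * a') * hxy + b' ^ 2 * hx₁ - b ^ 2 * hy₁
  have haa : a ^ 2 = a' ^ 2 := by linear_combination hx₁ - hy₁ + hbb
  have hab : b * a = b' * a' := by
    refine mul_right_cancel₀ hyb ?_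
    linear_combination b * hxy + a' * hbb
  refine mul_left_cancel₀ (mul_ne_zero hxb hxa) ?_
  linear_combination haa + hbb - y * hab - hx₂ + hy₂

end Critical

section Irreducible

lemma evalEval_swap {R : Type*} [CommSemiring R] (A : R[X][Y]) (x y : R) :
    (swap A).evalEval x y = A.evalEval y x := by
  simpa only [coe_aevalAeval_eq_evalEval] using aevalAeval_swap x y A

lemma eval_eval_X {R : Type*} [CommSemiring R] (A : R[X][Y]) (x : R) :
    (A.eval X).eval x = A.evalEval x x := by
  induction A using Polynomial.induction_on' with
  | add p q hp hq => simp_all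
  | monomial n f => simp [evalEval]

lemma isCoprime_of_simple_roots {K : Type*} [Field K] [IsAlgClosed K] {f g : K[X]}
    (h : ∀ x, (f * g).eval x = 0 → (derivative (f * g)).eval x ≠ 0) : IsCoprime f g := by
  refine (isCoprime_iff_aeval_ne_zero_of_isAlgClosed K K _ _).2 fun x ↦ ?_
  simp only [coe_aeval_eq_eval]
  by_contra! hx
  exact h x (by simp [hx.1]) (by simp [hx.1, hx.2])

variable {N : ℕ} {A B : ℂ[X][Y]}

lemma critical_of_evalEval_eq_zero (h : kernelS N = A * B) {x y : ℂ}
    (hA : A.evalEval x y = 0) (hB : B.evalEval x y = 0) :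
    ((kernelS N).eval X).eval x = 0 ∧
      (S ℂ (N + 1)).eval x * (S ℂ N).eval y = (S ℂ N).eval x * (S ℂ (N + 1)).eval y := by
  have hF := congrArg (eval (C y)) (sub_mul_kernelS N)
  simp only [h, eval_mul, eval_sub, eval_C, eval_X, eval_map_apply] at hF
  have h₀ := congrArg (eval x) hF
  have h₁ := congrArg (fun p ↦ (derivative p).eval x) hF
  simp only [derivative_mul, derivative_sub, derivative_X, derivative_C, eval_mul, eval_sub,
    eval_add, eval_C, eval_X, eval_zero, eval_one, hA, hB] at h₀ h₁
  refine ⟨?_, by linear_combination -h₀⟩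
  simp only [eval_X_kernelS, eval_mul, eval_sub]
  rcases eval_S_ne_zero_or N y with hy | hy
  · refine mul_left_cancel₀ hy ?_
    linear_combination -(S ℂ N).eval x * h₁ + (derivative (S ℂ N)).eval x * h₀
  · refine mul_left_cancel₀ hy ?_
    linear_combination -(S ℂ (N + 1)).eval x * h₁ + (derivative (S ℂ (N + 1))).eval x * h₀

lemma evalEval_ne_zero_of_kernelS_eq_mul (h : kernelS N = A * B) {x y : ℂ}
    (hA : A.evalEval x y = 0) : B.evalEval x y ≠ 0 := by
  intro hB
  have h' : kernelS N = swap A * swap B := by rw [← map_mul, ← h, swap_kernelS]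
  obtain ⟨hx, hxy⟩ := critical_of_evalEval_eq_zero h hA hB
  obtain ⟨hy, -⟩ := critical_of_evalEval_eq_zero (x := y) (y := x) h'
    (by rwa [evalEval_swap]) (by rwa [evalEval_swap])
  obtain rfl := eq_of_critical hx hy hxy
  refine eval_derivative_kernelS_ne_zero hx ?_
  rw [h, eval_mul, derivative_mul, eval_add, eval_mul, eval_mul, eval_eval_X, eval_eval_X, hA, hB]
  ring

lemma isUnit_of_natDegree_swap_eq_zero (hA : A ≠ 0) (h₁ : A.natDegree = 0)
    (h₂ : (swap A).natDegree = 0) : IsUnit A := by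
  obtain ⟨f, rfl⟩ := natDegree_eq_zero.1 h₁
  rw [swap_C, natDegree_map_eq_of_injective C_injective] at h₂
  obtain ⟨r, rfl⟩ := natDegree_eq_zero.1 h₂
  have hr : r ≠ 0 := by simpa using hA
  exact (hr.isUnit.map C).map C

theorem irreducible_kernelS (hN : N ≠ 0) : Irreducible (kernelS N) := by
  refine ⟨fun hu ↦ hN ?_, fun A B h ↦ ?_⟩
  · rw [← natDegree_kernelS N, natDegree_eq_zero_of_isUnit hu]
  have hAB : A * B ≠ 0 := h ▸ kernelS_ne_zero N
  have hA := left_ne_zero_of_mul hAB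
  have hB := right_ne_zero_of_mul hAB
  have hA' : swap A ≠ 0 := by simpa using hA
  have hB' : swap B ≠ 0 := by simpa using hB
  have h' : kernelS N = swap A * swap B := by rw [← map_mul, ← h, swap_kernelS]
  have hlc : A.leadingCoeff * B.leadingCoeff = S ℂ N := by
    rw [← leadingCoeff_mul, ← h, leadingCoeff_kernelS]
  have hlc' : (swap A).leadingCoeff * (swap B).leadingCoeff = S ℂ N := by
    rw [← leadingCoeff_mul, ← h', leadingCoeff_kernelS]
  have hd : A.natDegree + B.natDegree = N := by
    rw [← natDegree_mul hA hB, ← h, natDegree_kernelS]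
  have hd' : (swap A).natDegree + (swap B).natDegree = N := by
    rw [← natDegree_mul hA' hB', ← h', natDegree_kernelS]
  have hdl : (swap A).leadingCoeff.natDegree + (swap B).leadingCoeff.natDegree = N := by
    rw [← natDegree_mul (by simpa using hA) (by simpa using hB), hlc', (monic_and_natDegree_S N).2]
  have hAl : (swap A).leadingCoeff.natDegree ≤ A.natDegree := natDegree_coeff_swap_le A _
  have hBl : (swap B).leadingCoeff.natDegree ≤ B.natDegree := natDegree_coeff_swap_le B _
  by_cases hpos : (swap A).natDegree * B.natDegree + (swap B).natDegree * A.natDegree = 0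
  · obtain ⟨h₁, h₂⟩ := Nat.add_eq_zero_iff.1 hpos
    rcases Nat.mul_eq_zero.1 h₁ with h₁ | h₁ <;> rcases Nat.mul_eq_zero.1 h₂ with h₂ | h₂
    · lia
    · exact .inl (isUnit_of_natDegree_swap_eq_zero hA h₂ h₁)
    · exact .inr (isUnit_of_natDegree_swap_eq_zero hB h₁ h₂)
    · lia
  · obtain ⟨x, y, hx, hy⟩ := exists_evalEval_eq_zero A B
      (isCoprime_of_simple_roots fun x ↦ by rw [hlc]; exact eval_derivative_S_ne_zero)
      (isCoprime_of_simple_roots fun x ↦ by rw [hlc']; exact eval_derivative_S_ne_zero)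
      (by lia) hA hpos
    exact absurd hy (evalEval_ne_zero_of_kernelS_eq_mul h hx)

lemma not_sub_dvd_kernelS (N : ℕ) : ¬ (C X - Y : ℂ[X][Y]) ∣ kernelS N := by
  rintro ⟨G, hG⟩
  have h₀ : (kernelS N).eval X = 0 := by simp [hG]
  exact eval_derivative_kernelS_ne_zero (N := N) (x := 0) (by simp [h₀]) (by simp [h₀])

end Irreducible

lemma equivMvPolynomial_C_S (j : ℤ) :
    equivMvPolynomial ℂ (C (S ℂ j)) = aeval (MvPolynomial.X 0) (S ℤ j) := by
  rw [Chebyshev.aeval_S, ← Chebyshev.aeval_S (R := ℂ)]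
  generalize S ℂ j = p
  induction p using Polynomial.induction_on' with
  | add p q hp hq => simp only [map_add, hp, hq]
  | monomial n r => simp [← C_mul_X_pow_eq_monomial, MvPolynomial.algebraMap_eq]

lemma equivMvPolynomial_map_C_S (j : ℤ) :
    equivMvPolynomial ℂ ((S ℂ j).map C) = aeval (MvPolynomial.X 1) (S ℤ j) := by
  rw [Chebyshev.aeval_S, ← Chebyshev.aeval_S (R := ℂ)]
  generalize S ℂ j = p
  induction p using Polynomial.induction_on' with
  | add p q hp hq => simp only [Polynomial.map_add, map_add, hp, hq]
  | monomial n r => simp [← C_mul_X_pow_eq_monomial, MvPolynomial.algebraMap_eq]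

end Bivariate

end Polynomial

/-- Let `l = 2n+1` be an odd integer with `|l| > 3`, and let
`F(t,z) = S_n(t)·S_{n−1}(z) − S_{n−1}(t)·S_n(z)` in `ℂ[t,z]` (with `t` the variable
`X 0` and `z` the variable `X 1`).  Then `F = (t − z)·G` for a polynomial `G ∈ ℂ[t,z]`
that is irreducible and not divisible by `(t − z)`; in particular `F` has exactly two
distinct irreducible factors up to units, namely `t − z` and `G`.  Here `S : ℤ → ℤ[ω]`
satisfies `S 0 = 1`, `S 1 = ω` and `S (j+1) = ω·S j − S (j−1)` for all `j`. -/
theorem statement16 (S : ℤ → Polynomial ℤ)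
    (hS0 : S 0 = 1) (hS1 : S 1 = X)
    (hSrec : ∀ j : ℤ, S (j + 1) = X * S j - S (j - 1))
    (n : ℤ) (hl : 3 < |2 * n + 1|)
    (F : MvPolynomial (Fin 2) ℂ)
    (hF : F = Polynomial.aeval (MvPolynomial.X 0) (S n) *
          Polynomial.aeval (MvPolynomial.X 1) (S (n - 1)) -
        Polynomial.aeval (MvPolynomial.X 0) (S (n - 1)) *
          Polynomial.aeval (MvPolynomial.X 1) (S n)) :
    ∃ G : MvPolynomial (Fin 2) ℂ,
      F = (MvPolynomial.X 0 - MvPolynomial.X 1) * G ∧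
      Irreducible G ∧
      ¬ (MvPolynomial.X 0 - MvPolynomial.X 1) ∣ G := by
  obtain rfl : S = Chebyshev.S ℤ := by
    ext1 j
    induction j using Polynomial.Chebyshev.induct with
    | zero => rw [hS0, Chebyshev.S_zero]
    | one => rw [hS1, Chebyshev.S_one]
    | add_two j h₁ h₀ =>
      have := hSrec (j + 1)
      rw [show (j : ℤ) + 1 + 1 = j + 2 by ring, add_sub_cancel_right] at this
      rw [this, h₁, h₀, Chebyshev.S_add_two]
    | neg_add_one j h₁ h₀ =>
      have := hSrec (-j)
      rw [Chebyshev.S_sub_one, ← h₁, ← h₀, this]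
      ring
  have hF' : F = Bivariate.equivMvPolynomial ℂ (C (Chebyshev.S ℂ n) * (Chebyshev.S ℂ (n - 1)).map C -
      C (Chebyshev.S ℂ (n - 1)) * (Chebyshev.S ℂ n).map C) := by
    simp only [hF, map_sub, map_mul, Bivariate.equivMvPolynomial_C_S,
      Bivariate.equivMvPolynomial_map_C_S]
  obtain ⟨N, hN, u, hu⟩ : ∃ N : ℕ, N ≠ 0 ∧ ∃ u : ℂ[X][X]ˣ,
      F = Bivariate.equivMvPolynomial ℂ ((C X - X) * (Bivariate.kernelS N * (u : ℂ[X][X]))) := by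
    rw [hF']
    rcases lt_abs.1 hl with h | h
    · obtain ⟨N, rfl⟩ : ∃ N : ℕ, n = N + 1 := ⟨(n - 1).toNat, by lia⟩
      refine ⟨N, by lia, 1, ?_⟩
      rw [Units.val_one, mul_one, Bivariate.sub_mul_kernelS, add_sub_cancel_right]
    · obtain ⟨N, rfl⟩ : ∃ N : ℕ, n = -N - 2 := ⟨(-n - 2).toNat, by lia⟩
      refine ⟨N, by lia, -1, ?_⟩
      rw [Units.val_neg, Units.val_one, mul_neg_one, mul_neg, Bivariate.sub_mul_kernelS,
        Chebyshev.S_neg_sub_two, show -(N : ℤ) - 2 - 1 = -(N + 1 : ℤ) - 2 by ring,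
        Chebyshev.S_neg_sub_two]
      simp only [C_neg, Polynomial.map_neg]
      congr 1
      ring
  have hsub : (MvPolynomial.X 0 - MvPolynomial.X 1 : MvPolynomial (Fin 2) ℂ) =
      Bivariate.equivMvPolynomial ℂ (C X - X) := by simp
  refine ⟨Bivariate.equivMvPolynomial ℂ (Bivariate.kernelS N * (u : ℂ[X][X])), by rw [hu, hsub, ← map_mul], ?_, ?_⟩
  · rw [MulEquiv.irreducible_iff, irreducible_mul_units]
    exact Bivariate.irreducible_kernelS hN
  · rw [hsub, map_dvd_iff, Units.dvd_mul_right]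
    exact Bivariate.not_sub_dvd_kernelS N
end

section
/- For every integer m ≥ 1, the set of complex roots of the polynomial S_m + S_{m−1} is exactly { 2·cos(2·π·r/(2m+1)) : r ∈ ℤ, 1 ≤ r ≤ m }. -/
open Polynomial

/-- A sequence of integer polynomials satisfying the recurrence and the initial values of the
rescaled Chebyshev polynomials of the second kind is that sequence. -/
theorem eq_chebyshev_S_of_recurrence (S : ℤ → Polynomial ℤ)
    (hS0 : S 0 = 1) (hS1 : S 1 = X)
    (hSrec : ∀ j : ℤ, S (j + 1) = X * S j - S (j - 1)) (n : ℤ) :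
    S n = Chebyshev.S ℤ n := by
  induction n using Chebyshev.induct with
  | zero => simp [hS0]
  | one => simp [hS1]
  | add_two n h1 h0 =>
    have h := hSrec (n + 1)
    rw [show (n : ℤ) + 1 + 1 = n + 2 by ring, add_sub_cancel_right] at h
    rw [h, h1, h0, Chebyshev.S_add_two]
  | neg_add_one n h0 h1 =>
    have h := hSrec (-n)
    rw [h0, h1] at h
    rw [Chebyshev.S_sub_one]
    linear_combination h

theorem chebyshev_S_add_S_sub_one_mul_sin (φ : ℂ) (n : ℤ) :
    ((Chebyshev.S ℂ n).eval (2 * Complex.cos (2 * φ)) +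
      (Chebyshev.S ℂ (n - 1)).eval (2 * Complex.cos (2 * φ))) * Complex.sin φ =
      Complex.sin ((2 * n + 1) * φ) := by
  have sin_rec (a : ℂ) : Complex.sin (a + 2 * φ) + Complex.sin (a - 2 * φ) =
      2 * Complex.cos (2 * φ) * Complex.sin a := by
    rw [Complex.sin_add, Complex.sin_sub]
    ring
  induction n using Chebyshev.induct with
  | zero => simp
  | one =>
    have h := sin_rec φ
    rw [show φ - 2 * φ = -φ by ring, Complex.sin_neg] at h
    simp only [Chebyshev.S_one, sub_self, Chebyshev.S_zero, eval_X, eval_one, Int.cast_one]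
    rw [show (2 * 1 + 1) * φ = φ + 2 * φ by ring]
    linear_combination -h
  | add_two n h1 h0 =>
    have h := sin_rec ((2 * n + 3) * φ)
    have e1 := congrArg (eval (2 * Complex.cos (2 * φ))) (Chebyshev.S_add_two ℂ n)
    have e0 := congrArg (eval (2 * Complex.cos (2 * φ))) (Chebyshev.S_add_one ℂ n)
    simp only [eval_sub, eval_mul, eval_X] at e1 e0
    push_cast at h0 h1 ⊢
    rw [add_sub_cancel_right] at h1
    rw [show (n : ℤ) + 2 - 1 = n + 1 by ring]
    rw [show (2 * n + 3 : ℂ) * φ + 2 * φ = (2 * (n + 2) + 1) * φ by ring,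
      show (2 * n + 3 : ℂ) * φ - 2 * φ = (2 * n + 1) * φ by ring,
      show (2 * n + 3 : ℂ) * φ = (2 * (n + 1) + 1) * φ by ring] at h
    rw [e1]
    linear_combination Complex.sin φ * e0 - h + 2 * Complex.cos (2 * φ) * h1 - h0
  | neg_add_one n h0 h1 =>
    have h := sin_rec ((-2 * n + 1) * φ)
    have e1 := congrArg (eval (2 * Complex.cos (2 * φ))) (Chebyshev.S_sub_two ℂ (-n))
    have e0 := congrArg (eval (2 * Complex.cos (2 * φ))) (Chebyshev.S_sub_one ℂ (-n))
    simp only [eval_sub, eval_mul, eval_X] at e1 e0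
    push_cast at h0 h1 ⊢
    rw [add_sub_cancel_right] at h1
    rw [show -(n : ℤ) - 1 - 1 = -n - 2 by ring]
    rw [show (-2 * n + 1 : ℂ) * φ + 2 * φ = (2 * (-n + 1) + 1) * φ by ring,
      show (-2 * n + 1 : ℂ) * φ - 2 * φ = (2 * (-n - 1) + 1) * φ by ring,
      show (-2 * n + 1 : ℂ) * φ = (2 * (-n) + 1) * φ by ring] at h
    rw [e1]
    linear_combination Complex.sin φ * e0 - h + 2 * Complex.cos (2 * φ) * h0 - h1

/-- The values of `cos (2πk/(2m+1))` with `2m+1 ∤ k` are attained for `1 ≤ k ≤ m`. -/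
theorem exists_cos_two_pi_mul_div_eq {m k : ℤ} (hm : 1 ≤ m) (hk : ¬ (2 * m + 1) ∣ k) :
    ∃ r : ℤ, 1 ≤ r ∧ r ≤ m ∧ Real.cos (2 * Real.pi * k / (2 * m + 1)) =
      Real.cos (2 * Real.pi * r / (2 * m + 1)) := by
  have hN : (2 * m + 1 : ℝ) ≠ 0 := by
    have : (1 : ℝ) ≤ m := by exact_mod_cast hm
    positivity
  have h0 := Int.emod_nonneg k (show 2 * m + 1 ≠ 0 by lia)
  have h1 := Int.emod_lt_of_pos k (show 0 < 2 * m + 1 by lia)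
  have h2 : k % (2 * m + 1) ≠ 0 := fun h => hk (Int.dvd_of_emod_eq_zero h)
  have h3 : (k : ℝ) = (k % (2 * m + 1) : ℤ) + (2 * m + 1) * (k / (2 * m + 1) : ℤ) := by
    exact_mod_cast (Int.emod_add_mul_ediv k (2 * m + 1)).symm
  have h4 : Real.cos (2 * Real.pi * k / (2 * m + 1)) =
      Real.cos (2 * Real.pi * (k % (2 * m + 1) : ℤ) / (2 * m + 1)) := by
    rw [← Real.cos_add_int_mul_two_pi (2 * Real.pi * (k % (2 * m + 1) : ℤ) / (2 * m + 1)) (k / (2 * m + 1))]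
    congr 1
    rw [h3]
    field_simp
  by_cases hle : k % (2 * m + 1) ≤ m
  · exact ⟨_, by lia, hle, h4⟩
  · refine ⟨2 * m + 1 - k % (2 * m + 1), by lia, by lia, ?_⟩
    rw [h4, ← Real.cos_two_pi_sub]
    congr 1
    push_cast
    field_simp

/-- For every integer `m ≥ 1`, the set of complex roots of `S_m + S_{m−1}`
is exactly `{ 2·cos(2·π·r/(2m+1)) : r ∈ ℤ, 1 ≤ r ≤ m }`.  Here `S : ℤ → ℤ[ω]`
satisfies `S 0 = 1`, `S 1 = ω` and `S (j+1) = ω·S j − S (j−1)` for all `j`. -/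
theorem statement19 (S : ℤ → Polynomial ℤ)
    (hS0 : S 0 = 1) (hS1 : S 1 = X)
    (hSrec : ∀ j : ℤ, S (j + 1) = X * S j - S (j - 1)) :
    ∀ m : ℤ, 1 ≤ m →
      {x : ℂ | Polynomial.aeval x (S m + S (m - 1)) = 0} =
        {x : ℂ | ∃ r : ℤ, 1 ≤ r ∧ r ≤ m ∧
          x = ((2 * Real.cos (2 * Real.pi * (r : ℝ) / (2 * (m : ℝ) + 1)) : ℝ) : ℂ)} := by
  intro m hm
  have hmR : (1 : ℝ) ≤ m := by exact_mod_cast hm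
  have hNR : (2 * m + 1 : ℝ) ≠ 0 := by positivity
  have hN : (2 * m + 1 : ℂ) ≠ 0 := by exact_mod_cast hNR
  ext x
  simp only [Set.mem_ofPred_eq, eq_chebyshev_S_of_recurrence S hS0 hS1 hSrec, map_add,
    Chebyshev.aeval_S]
  constructor
  · intro hx
    obtain ⟨θ, hθ⟩ := Complex.cos_surjective (x / 2)
    obtain ⟨φ, rfl⟩ : ∃ φ, θ = 2 * φ := ⟨θ / 2, by ring⟩
    obtain rfl : x = 2 * Complex.cos (2 * φ) := by rw [hθ]; ring
    have hsin := chebyshev_S_add_S_sub_one_mul_sin φ m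
    rw [hx, zero_mul, eq_comm, Complex.sin_eq_zero_iff] at hsin
    obtain ⟨k, hk⟩ := hsin
    have hφ : φ = k * Real.pi / (2 * m + 1) := by
      rw [eq_div_iff hN, ← hk]; ring
    have hdvd : ¬ (2 * m + 1) ∣ k := by
      rintro ⟨c, rfl⟩
      have hcos : Complex.cos (2 * φ) = 1 := by
        rw [Complex.cos_eq_one_iff]
        refine ⟨c, ?_⟩
        rw [hφ]
        push_cast
        field_simp
      rw [hcos, mul_one, Chebyshev.S_eval_two, Chebyshev.S_eval_two] at hx
      apply hN
      push_cast at hx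
      linear_combination hx
    obtain ⟨r, h1, h2, h3⟩ := exists_cos_two_pi_mul_div_eq hm hdvd
    refine ⟨r, h1, h2, ?_⟩
    rw [← h3, hφ]
    push_cast
    ring_nf
  · rintro ⟨r, hr1, hrm, rfl⟩
    have hr1R : (1 : ℝ) ≤ r := by exact_mod_cast hr1
    have hrmR : (r : ℝ) ≤ m := by exact_mod_cast hrm
    have hpos : 0 < Real.sin (Real.pi * r / (2 * m + 1)) := by
      apply Real.sin_pos_of_pos_of_lt_pi
      · have := Real.pi_pos
        positivity
      · rw [div_lt_iff₀ (by positivity)]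
        exact mul_lt_mul_of_pos_left (by linarith) Real.pi_pos
    have hsin := chebyshev_S_add_S_sub_one_mul_sin (Real.pi * r / (2 * m + 1) : ℝ) m
    have hzero : Complex.sin ((2 * m + 1) * (Real.pi * r / (2 * m + 1) : ℝ)) = 0 := by
      rw [Complex.sin_eq_zero_iff]
      refine ⟨r, ?_⟩
      push_cast
      field_simp
    have hne : Complex.sin (Real.pi * r / (2 * m + 1) : ℝ) ≠ 0 := by
      exact_mod_cast hpos.ne'
    have hcos : ((2 * Real.cos (2 * Real.pi * r / (2 * m + 1)) : ℝ) : ℂ) =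
        2 * Complex.cos (2 * (Real.pi * r / (2 * m + 1) : ℝ)) := by
      push_cast
      ring_nf
    rw [hcos]
    rw [hzero] at hsin
    exact (mul_eq_zero.mp hsin).resolve_right hne
end
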